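/- arXiv:2205.05647 — 2 statements merged into one kernel-verified Lean document; each statement's English description precedes it below -/
import Mathlib

section
/- Let P₁, …, P_m ⊆ ℝ^d (d ≥ 1, m ≥ 1) be polytopes in general position, each of dimension at least 1. Then the number of extreme points of the Minkowski sum P₁ + ⋯ + P_m satisfies v(P₁ + ⋯ + P_m) ≥ Σ_{i=1}^m v(P_i) + 2·Σ_{k=0}^{d−1} C(m−1, k) − 2m, where C(·,·) denotes the binomial coefficient. -/
open Pointwise

/-- A polytope in `ℝ^d`: the convex hull of a nonempty finite set of points. -/
def IsPolytope {d : ℕ} (P : Set (Fin d → ℝ)) : Prop :=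
  ∃ S : Finset (Fin d → ℝ), S.Nonempty ∧ P = convexHull ℝ (S : Set (Fin d → ℝ))

/-- The dimension of a convex set: the rank of the direction of its affine span. -/
noncomputable def polyDim {d : ℕ} (P : Set (Fin d → ℝ)) : ℕ :=
  Module.finrank ℝ ↥(vectorSpan ℝ P)

/-- The face of `P` in the direction of the linear functional `c`. -/
def face {d : ℕ} (c : (Fin d → ℝ) →ₗ[ℝ] ℝ) (P : Set (Fin d → ℝ)) : Set (Fin d → ℝ) :=
  {x ∈ P | ∀ y ∈ P, c y ≤ c x}

/-- Polytopes `P₁, …, P_m` are in general position if for every nonzero linear functional `c`,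
the dimension of the Minkowski sum of the faces `F^c(Pᵢ)` equals the sum of their dimensions. -/
def InGeneralPosition {d m : ℕ} (P : Fin m → Set (Fin d → ℝ)) : Prop :=
  ∀ c : (Fin d → ℝ) →ₗ[ℝ] ℝ, c ≠ 0 →
    polyDim (∑ i, face c (P i)) = ∑ i, polyDim (face c (P i))

/-- The points of `V` at which `c` attains its maximum over `V`. -/
def maximizers {E : Type*} (c : E → ℝ) (V : Set E) : Set E := {x ∈ V | ∀ y ∈ V, c y ≤ c x}

section maximizers

variable {E : Type*}

lemma maximizers_subset (c : E → ℝ) (V : Set E) : maximizers c V ⊆ V := fun _ hx => hx.1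

lemma Set.Finite.maximizers_nonempty {V : Set E} (hV : V.Finite) (hne : V.Nonempty) (c : E → ℝ) :
    (maximizers c V).Nonempty := by
  obtain ⟨x, hx, h⟩ := Set.exists_max_image V c hV hne
  exact ⟨x, hx, h⟩

lemma eq_of_mem_maximizers {c : E → ℝ} {V : Set E} {x y : E} (hx : x ∈ maximizers c V)
    (hy : y ∈ maximizers c V) : c x = c y :=
  le_antisymm (hy.2 x hx.1) (hx.2 y hy.1)

/-- On a line of functions `h + s • g` with `g` non-constant on `V`, some function has a tie. -/
lemma exists_nontrivial_maximizers_line {V : Set E} (hV : V.Finite) (h g : E → ℝ)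
    (hg : ∃ x ∈ V, ∃ y ∈ V, g x ≠ g y) :
    ∃ s : ℝ, (maximizers (fun x => h x + s * g x) V).Nontrivial := by
  obtain ⟨x, hx, y, hy, hxy⟩ := hg
  have hVne : V.Nonempty := ⟨x, hx⟩
  have hMfin : (maximizers g V).Finite := hV.subset (maximizers_subset _ _)
  obtain ⟨p, hpM, hp⟩ := Set.exists_max_image _ h hMfin (hV.maximizers_nonempty hVne g)
  have hlow : ({r ∈ V | g r < g p}).Nonempty := by
    rcases lt_or_gt_of_ne hxy with hlt | hlt
    · exact ⟨x, hx, hlt.trans_le (hpM.2 y hy)⟩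
    · exact ⟨y, hy, hlt.trans_le (hpM.2 x hx)⟩
  obtain ⟨q, ⟨hqV, hqp⟩, hq⟩ := Set.exists_max_image _ (fun r => (h r - h p) / (g p - g r))
    (hV.subset (Set.sep_subset _ _)) hlow
  set s := (h q - h p) / (g p - g q) with hs
  have hsq : s * (g p - g q) = h q - h p := div_mul_cancel₀ _ (sub_pos.2 hqp).ne'
  have hmax : ∀ r ∈ V, h r + s * g r ≤ h p + s * g p := by
    intro r hr
    rcases (hpM.2 r hr).lt_or_eq with hlt | heq
    · have := (div_le_iff₀ (sub_pos.2 hlt)).1 (hq r ⟨hr, hlt⟩)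
      nlinarith
    · have := hp r ⟨hr, fun z hz => heq ▸ hpM.2 z hz⟩
      rw [heq]
      linarith
  refine ⟨s, p, ⟨hpM.1, hmax⟩, q, ⟨hqV, fun r hr => (hmax r hr).trans ?_⟩, ?_⟩
  · show h p + s * g p ≤ h q + s * g q
    nlinarith
  · rintro rfl
    exact hqp.false

/-- Maximizers of a perturbed functional among the old maximizers survive small perturbations. -/
lemma eventually_mem_maximizers {V : Set E} (hV : V.Finite) {c c' : E → ℝ} {p : E}
    (hp : p ∈ maximizers c' (maximizers c V)) :
    ∀ᶠ ε : ℝ in nhdsWithin 0 (Set.Ioi 0), p ∈ maximizers (fun x => c x + ε * c' x) V := by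
  have key : ∀ r ∈ V, ∀ᶠ ε : ℝ in nhdsWithin 0 (Set.Ioi 0), c r + ε * c' r ≤ c p + ε * c' p := by
    intro r hr
    rcases (hp.1.2 r hr).lt_or_eq with hlt | heq
    · have h1 : ContinuousAt (fun ε : ℝ => c r + ε * c' r) 0 := by fun_prop
      have h2 : ContinuousAt (fun ε : ℝ => c p + ε * c' p) 0 := by fun_prop
      exact (h1.eventually_lt h2 (by simpa using hlt)).filter_mono nhdsWithin_le_nhds |>.mono
        fun _ h => h.le
    · have hr' : c' r ≤ c' p := hp.2 r ⟨hr, fun z hz => heq ▸ hp.1.2 z hz⟩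
      filter_upwards [self_mem_nhdsWithin] with ε hε
      rw [heq]
      have : ε * c' r ≤ ε * c' p := mul_le_mul_of_nonneg_left hr' (le_of_lt hε)
      linarith
  filter_upwards [(Filter.eventually_all_finite hV).2 key] with ε hε
  exact ⟨hp.1.1, hε⟩

end maximizers

section ties

variable {E : Type*} [NormedAddCommGroup E] [NormedSpace ℝ E]

lemma isClosed_setOf_mem_maximizers (V : Set E) (p : E) :
    IsClosed {c : StrongDual ℝ E | p ∈ maximizers c V} := by
  by_cases hp : p ∈ V
  · have : {c : StrongDual ℝ E | p ∈ maximizers c V} = ⋂ y ∈ V, {c | c y ≤ c p} := by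
      ext c
      simp [maximizers, hp]
    rw [this]
    exact isClosed_biInter fun y _ => isClosed_le (by fun_prop) (by fun_prop)
  · simp [maximizers, hp]

lemma isClosed_setOf_exists_mem_maximizers {V A : Set E} (hA : A.Finite) :
    IsClosed {c : StrongDual ℝ E | ∃ p ∈ A, p ∈ maximizers c V} := by
  have : {c : StrongDual ℝ E | ∃ p ∈ A, p ∈ maximizers c V} =
      ⋃ p ∈ A, {c : StrongDual ℝ E | p ∈ maximizers c V} := by
    ext c
    simp
  rw [this]
  exact hA.isClosed_biUnion fun p _ => isClosed_setOf_mem_maximizers V p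

lemma isClosed_setOf_nontrivial_maximizers {V : Set E} (hV : V.Finite) :
    IsClosed {c : StrongDual ℝ E | (maximizers c V).Nontrivial} := by
  have : {c : StrongDual ℝ E | (maximizers c V).Nontrivial} =
      ⋃ p ∈ V, ({c : StrongDual ℝ E | p ∈ maximizers c V} ∩
        {c : StrongDual ℝ E | ∃ q ∈ V \ {p}, q ∈ maximizers c V}) := by
    ext c
    simp only [Set.Nontrivial, Set.mem_ofPred_eq, Set.mem_iUnion, Set.mem_inter_iff, Set.mem_sdiff,
      Set.mem_singleton_iff]
    constructor
    · rintro ⟨p, hp, q, hq, hpq⟩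
      exact ⟨p, hp.1, hp, q, ⟨hq.1, hpq.symm⟩, hq⟩
    · rintro ⟨p, _, hp, q, ⟨_, hpq⟩, hq⟩
      exact ⟨p, hp, q, hq, Ne.symm hpq⟩
  rw [this]
  exact hV.isClosed_biUnion fun p _ => (isClosed_setOf_mem_maximizers V p).inter
    (isClosed_setOf_exists_mem_maximizers (hV.subset Set.sdiff_subset))

lemma maximizers_smul (c : StrongDual ℝ E) {t : ℝ} (ht : 0 < t) (V : Set E) :
    maximizers (t • c) V = maximizers c V := by
  ext x
  simp [maximizers, ht]

lemma apply_eq_zero_of_mem_vectorSpan_maximizers {c : StrongDual ℝ E} {V : Set E} {x : E}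
    (hx : x ∈ vectorSpan ℝ (maximizers c V)) : c x = 0 := by
  have : vectorSpan ℝ (maximizers c V) ≤ c.toLinearMap.ker := by
    rw [vectorSpan_def, Submodule.span_le]
    rintro _ ⟨a, ha, b, hb, rfl⟩
    simp [eq_of_mem_maximizers ha hb]
  exact this hx

variable [FiniteDimensional ℝ E]

/-- A generic direction `w` can be increased while keeping the ties of `c` in the sets
`V i`, `i ∈ S`, and fixing the value at `u`. -/
lemma exists_improving_direction {ι : Type*} [DecidableEq ι] {V : ι → Set E}
    (hV : ∀ i, (V i).Finite) {c : StrongDual ℝ E}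
    (hind : iSupIndep fun i => vectorSpan ℝ (maximizers c (V i))) {S : Finset ι}
    (htie : ∀ i ∈ S, (maximizers c (V i)).Nontrivial) {u w : E} (hu : c u ≠ 0)
    (hw : ∀ e : ι → E, (∀ i ∈ S, e i ∈ V i - V i) →
      w ∉ Submodule.span ℝ (insert u (e '' (S : Set ι)))) :
    ∃ c' : StrongDual ℝ E, c' u = 0 ∧ 0 < c' w ∧
      ∀ i ∈ S, (maximizers c' (maximizers c (V i))).Nontrivial := by
  set L : ι → Submodule ℝ E := fun i => vectorSpan ℝ (maximizers c (V i)) with hL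
  have hmemL : ∀ i, ∀ p ∈ maximizers c (V i), ∀ q ∈ maximizers c (V i), p - q ∈ L i :=
    fun i p hp q hq => vsub_mem_vectorSpan ℝ hp hq
  have hkeep : ∀ (c' : StrongDual ℝ E) (i : ι), i ∈ S → (∀ x ∈ L i, c' x = 0) →
      (maximizers c' (maximizers c (V i))).Nontrivial := by
    intro c' i hi h0
    have heq : maximizers c' (maximizers c (V i)) = maximizers c (V i) := by
      refine (maximizers_subset _ _).antisymm fun p hp => ⟨hp, fun q hq => ?_⟩
      have := h0 _ (hmemL i q hq p hp)
      rw [map_sub] at this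
      linarith
    rw [heq]
    exact htie i hi
  by_cases hwM : w ∈ (⨆ i ∈ S, L i) ⊔ Submodule.span ℝ {u}
  swap
  · obtain ⟨f, hfw, hf⟩ := Submodule.exists_le_ker_of_notMem hwM
    have hfL : ∀ i ∈ S, ∀ x ∈ L i, f x = 0 := fun i hi x hx =>
      hf (Submodule.mem_sup_left (Submodule.mem_iSup_of_mem i (Submodule.mem_iSup_of_mem hi hx)))
    have hfu : f u = 0 := hf (Submodule.mem_sup_right (Submodule.mem_span_singleton_self u))
    refine ⟨(f w) • LinearMap.toContinuousLinearMap f, by simp [hfu], ?_, fun i hi =>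
      hkeep _ i hi fun x hx => by simp [hfL i hi x hx]⟩
    simpa using mul_self_pos.2 hfw
  choose! p hp q hq hpq using htie
  obtain ⟨y, hy, z, hz, rfl⟩ := Submodule.mem_sup.1 hwM
  obtain ⟨x, rfl⟩ := (Submodule.mem_iSup_finset_iff_exists_sum _ _).1 hy
  obtain ⟨a, rfl⟩ := Submodule.mem_span_singleton.1 hz
  obtain ⟨i, hi, hxi⟩ : ∃ i ∈ S, (x i : E) ∉ Submodule.span ℝ {p i - q i} := by
    by_contra! hcon
    refine hw (fun i => p i - q i) (fun i hi => Set.sub_mem_sub (hp i hi).1 (hq i hi).1)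
      (add_mem (sum_mem fun i hi => ?_) ?_)
    · refine Submodule.span_mono ?_ (hcon i hi)
      rintro _ rfl
      exact Or.inr ⟨i, hi, rfl⟩
    · exact Submodule.smul_mem _ _ (Submodule.subset_span (Or.inl rfl))
  set N : Submodule ℝ E := (⨆ j ≠ i, L j) ⊔ Submodule.span ℝ {u} with hN
  have hcL : ∀ i, ∀ x ∈ L i, c x = 0 := fun i x hx => apply_eq_zero_of_mem_vectorSpan_maximizers hx
  have hdisj : ∀ v ∈ L i, v ∈ N → v = 0 := by
    intro v hv hvN
    obtain ⟨v₁, hv₁, v₂, hv₂, rfl⟩ := Submodule.mem_sup.1 hvN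
    obtain ⟨b, rfl⟩ := Submodule.mem_span_singleton.1 hv₂
    have hker : (⨆ j ≠ i, L j) ≤ c.toLinearMap.ker := iSup₂_le fun j _ x hx => hcL j x hx
    have hb : b = 0 := by
      have h1 := hcL i _ hv
      have h2 : c v₁ = 0 := hker hv₁
      simpa [h2, hu] using h1
    subst hb
    rw [zero_smul, add_zero] at hv ⊢
    exact Submodule.disjoint_def.1 (hind i) v₁ hv hv₁
  set e := p i - q i with he
  have heL : e ∈ L i := hmemL i _ (hp i hi) _ (hq i hi)
  have he0 : e ≠ 0 := sub_ne_zero.2 (hpq i hi)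
  have hxe : (x i : E) ∉ N := fun h => hxi (by rw [hdisj _ (x i).2 h]; exact zero_mem _)
  have hex : e ∉ N ⊔ Submodule.span ℝ {(x i : E)} := by
    intro h
    obtain ⟨v₁, hv₁, v₂, hv₂, hv⟩ := Submodule.mem_sup.1 h
    obtain ⟨b, rfl⟩ := Submodule.mem_span_singleton.1 hv₂
    have h1 : v₁ = 0 := hdisj v₁ (by
      rw [← sub_eq_iff_eq_add.2 hv.symm]
      exact sub_mem heL (Submodule.smul_mem _ _ (x i).2)) hv₁
    rw [h1, zero_add] at hv
    have hb : b ≠ 0 := by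
      rintro rfl
      exact he0 (by rw [← hv, zero_smul])
    refine hxi (Submodule.mem_span_singleton.2 ⟨b⁻¹, ?_⟩)
    rw [← hv, smul_smul, inv_mul_cancel₀ hb, one_smul]
  obtain ⟨h, hhx, hhN⟩ := Submodule.exists_le_ker_of_notMem hxe
  obtain ⟨g, hge, hgN⟩ := Submodule.exists_le_ker_of_notMem hex
  obtain ⟨s, hs⟩ := exists_nontrivial_maximizers_line ((hV i).subset (maximizers_subset c _))
    (fun v => h (x i) * h v) g ⟨p i, hp i hi, q i, hq i hi, fun hc => hge (by simp [he, hc])⟩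
  set f : E →ₗ[ℝ] ℝ := h (x i) • h + s • g with hf
  have hfN : ∀ v ∈ N, f v = 0 := fun v hv => by
    have h1 : h v = 0 := hhN hv
    have h2 : g v = 0 := hgN (Submodule.mem_sup_left hv)
    simp [hf, h1, h2]
  have hfL : ∀ j ≠ i, ∀ v ∈ L j, f v = 0 := fun j hj v hv => hfN v
    (Submodule.mem_sup_left (Submodule.mem_iSup_of_mem j (Submodule.mem_iSup_of_mem hj hv)))
  have hfu : f u = 0 := hfN u (Submodule.mem_sup_right (Submodule.mem_span_singleton_self u))
  have hgx : g (x i) = 0 := hgN (Submodule.mem_sup_right (Submodule.mem_span_singleton_self _))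
  refine ⟨LinearMap.toContinuousLinearMap f, by simpa using hfu, ?_, fun j hj => ?_⟩
  · have : f (∑ j ∈ S, (x j : E)) = f (x i) := by
      rw [map_sum]
      exact Finset.sum_eq_single i (fun j _ hji => hfL j hji _ (x j).2) fun h => absurd hi h
    simp only [LinearMap.coe_toContinuousLinearMap', map_add, map_smul, this, hfu, smul_zero,
      add_zero]
    simpa [hf, hgx] using mul_self_pos.2 hhx
  · by_cases hji : j = i
    · subst hji
      exact hs
    · exact hkeep _ j hj fun v hv => by simpa using hfL j hji v hv

end ties

/-- A family of finite sets, none a singleton, whose faces in any common direction span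
independent subspaces. -/
structure IsGenericFamily {ι E : Type*} [NormedAddCommGroup E] [NormedSpace ℝ E]
    (V : ι → Set E) : Prop where
  finite : ∀ i, (V i).Finite
  nontrivial : ∀ i, (V i).Nontrivial
  iSupIndep : ∀ c : StrongDual ℝ E, c ≠ 0 →
    iSupIndep fun i => vectorSpan ℝ (maximizers c (V i))

namespace IsGenericFamily

variable {ι E : Type*} [NormedAddCommGroup E] [NormedSpace ℝ E] {V : ι → Set E}

lemma exists_mem_maximizers (hV : IsGenericFamily V) (c : StrongDual ℝ E) (i : ι) :
    ∃ x, x ∈ maximizers c (V i) :=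
  (hV.finite i).maximizers_nonempty (hV.nontrivial i).nonempty c

variable [FiniteDimensional ℝ E]

lemma exists_ties_of_generic [DecidableEq ι] (hV : IsGenericFamily V) {w : E}
    (hw : ∀ B : Set E, B ⊆ ⋃ i, (V i - V i) → B.Finite → B.ncard < Module.finrank ℝ E →
      w ∉ Submodule.span ℝ B)
    (S : Finset ι) (hS : S.card < Module.finrank ℝ E) :
    ∃ c : StrongDual ℝ E, c ≠ 0 ∧ 0 ≤ c w ∧ ∀ i ∈ S, (maximizers c (V i)).Nontrivial := by
  induction S using Finset.induction_on with
  | empty =>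
    have hw0 : w ≠ 0 := fun h => hw ∅ (Set.empty_subset _) Set.finite_empty
      (by simpa using hS) (by simp [h])
    obtain ⟨f, hf⟩ := exists_dual_vector ℝ w (norm_ne_zero_iff.2 hw0)
    refine ⟨f, ?_, ?_, by simp⟩
    · rintro rfl
      simp at hf
    · rw [hf.2]
      simp
  | insert k S hk ih =>
    rw [Finset.card_insert_of_notMem hk] at hS
    obtain ⟨c₀, hc₀, hc₀w, hc₀S⟩ := ih (by omega)
    by_contra! hno
    have htie : ∀ c : StrongDual ℝ E, c ≠ 0 → 0 ≤ c w →
        (∀ i ∈ S, (maximizers c (V i)).Nontrivial) → (maximizers c (V k)).Subsingleton := by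
      intro c hc hcw hcS
      obtain ⟨i, hi, hi'⟩ := hno c hc hcw
      rcases Finset.mem_insert.1 hi with rfl | hi
      · exact hi'
      · exact absurd (hcS i hi) (Set.not_nontrivial_iff.2 hi')
    obtain ⟨q, hq⟩ := hV.exists_mem_maximizers c₀ k
    obtain ⟨q', hq', hqq'⟩ := (hV.nontrivial k).exists_ne q
    set u := q' - q with hu
    set K : Set (StrongDual ℝ E) := Metric.sphere 0 1 ∩
      ({c | q ∈ maximizers c (V k)} ∩ ({c | 0 ≤ c w} ∩
        ⋂ i ∈ S, {c | (maximizers c (V i)).Nontrivial})) with hK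
    have hmemK : ∀ c, c ∈ K ↔ ‖c‖ = 1 ∧ q ∈ maximizers c (V k) ∧ 0 ≤ c w ∧
        ∀ i ∈ S, (maximizers c (V i)).Nontrivial := by
      intro c
      simp [hK]
    have hKc : IsCompact K := (isCompact_sphere 0 1).inter_right
      ((isClosed_setOf_mem_maximizers _ _).inter
        ((isClosed_le continuous_const (by fun_prop)).inter
          (isClosed_biInter fun i _ => isClosed_setOf_nontrivial_maximizers (hV.finite i))))
    have hneg : ∀ c ∈ K, c u < 0 := by
      intro c hc
      obtain ⟨h1, h2, h3, h4⟩ := (hmemK c).1 hc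
      have hc0 : c ≠ 0 := by
        rintro rfl
        simp at h1
      rw [hu, map_sub, sub_neg]
      refine lt_of_le_of_ne (h2.2 q' hq') fun heq => hqq' ?_
      exact htie c hc0 h3 h4 ⟨hq', fun y hy => heq ▸ h2.2 y hy⟩ h2
    have hscale : ∀ c : StrongDual ℝ E, c ≠ 0 → q ∈ maximizers c (V k) → 0 ≤ c w →
        (∀ i ∈ S, (maximizers c (V i)).Nontrivial) → ‖c‖⁻¹ • c ∈ K := by
      intro c hc hcq hcw hcS
      have hpos : 0 < ‖c‖⁻¹ := inv_pos.2 (norm_pos_iff.2 hc)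
      have hmax : ∀ W : Set E, maximizers (‖c‖⁻¹ • c) W = maximizers c W := maximizers_smul c hpos
      refine (hmemK _).2 ⟨norm_smul_inv_norm hc, ?_, mul_nonneg hpos.le hcw, fun i hi => ?_⟩
      · exact (hmax _).symm ▸ hcq
      · exact (hmax _).symm ▸ hcS i hi
    obtain ⟨c, hcK, hcmax⟩ := hKc.exists_isMaxOn (f := fun c : StrongDual ℝ E => c w / -c u)
      ⟨_, hscale c₀ hc₀ hq hc₀w hc₀S⟩
      (ContinuousOn.div (by fun_prop) (by fun_prop) fun c hc => (neg_pos.2 (hneg c hc)).ne')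
    obtain ⟨hc1, hcq, hcw, hcS⟩ := (hmemK c).1 hcK
    have hc0 : c ≠ 0 := by
      rintro rfl
      simp at hc1
    obtain ⟨c', hc'u, hc'w, hc'S⟩ := exists_improving_direction (w := w) hV.finite
      (hV.iSupIndep c hc0) hcS (hneg c hcK).ne fun e he => hw _
        (Set.insert_subset (Set.mem_iUnion.2 ⟨k, Set.sub_mem_sub hq' hcq.1⟩) (by
          rintro _ ⟨i, hi, rfl⟩
          exact Set.mem_iUnion.2 ⟨i, he i hi⟩))
        ((S.finite_toSet.image e).insert _)
        ((Set.ncard_insert_le _ _).trans_lt (lt_of_le_of_lt (Nat.add_le_add_right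
          (Set.ncard_image_le S.finite_toSet) 1) (by simpa using hS)))
    have hc'q : q ∈ maximizers c' (maximizers c (V k)) :=
      ⟨hcq, fun r hr => by rw [htie c hc0 hcw hcS hr hcq]⟩
    choose! p hp r hr hpr using hc'S
    have hev : ∀ᶠ ε : ℝ in nhdsWithin 0 (Set.Ioi 0),
        (∀ i ∈ S, (maximizers (fun x => c x + ε * c' x) (V i)).Nontrivial) := by
      rw [Filter.eventually_all_finset]
      intro i hi
      filter_upwards [eventually_mem_maximizers (hV.finite i) (hp i hi),
        eventually_mem_maximizers (hV.finite i) (hr i hi)] with ε h1 h2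
      exact ⟨_, h1, _, h2, hpr i hi⟩
    obtain ⟨ε, ⟨hεS, hεq⟩, hε⟩ := ((hev.and
      (eventually_mem_maximizers (hV.finite k) hc'q)).and self_mem_nhdsWithin).exists
    have hε : 0 < ε := hε
    set b := c + ε • c' with hb
    have hbu : b u = c u := by simp [hb, hc'u]
    have hbw : c w < b w := by
      have := mul_pos hε hc'w
      simpa [hb] using this
    have hb0 : b ≠ 0 := by
      intro h
      have := hneg c hcK
      rw [← hbu, h] at this
      simp at this
    have hbK := hscale b hb0 hεq (hcw.trans hbw.le) hεS
    have hle : (‖b‖⁻¹ • b) w / -(‖b‖⁻¹ • b) u ≤ c w / -c u := hcmax hbK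
    have hbn : ‖b‖⁻¹ ≠ 0 := inv_ne_zero (norm_ne_zero_iff.2 hb0)
    have heq : (‖b‖⁻¹ • b) w / -(‖b‖⁻¹ • b) u = b w / -c u := by
      rw [← hbu]
      simp only [smul_apply, smul_eq_mul]
      rw [← mul_neg, mul_div_mul_left _ _ hbn]
    rw [heq] at hle
    exact absurd hle (not_le.2 (div_lt_div_of_pos_right hbw (neg_pos.2 (hneg c hcK))))

lemma exists_generic_near [Finite ι] (hV : IsGenericFamily V) (u : E) {δ : ℝ} (hδ : 0 < δ) :
    ∃ w, dist w u < δ ∧ ∀ B : Set E, B ⊆ ⋃ i, (V i - V i) → B.Finite →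
      B.ncard < Module.finrank ℝ E → w ∉ Submodule.span ℝ B := by
  set 𝓑 : Set (Set E) := {B | B ⊆ ⋃ i, (V i - V i) ∧ B.Finite ∧ B.ncard < Module.finrank ℝ E}
  have hfin : (⋃ i, (V i - V i)).Finite := Set.finite_iUnion fun i =>
    (hV.finite i).sub (hV.finite i)
  have h𝓑 : 𝓑.Finite := hfin.finite_subsets.subset fun B hB => hB.1
  have hdense : Dense (⋂ B ∈ 𝓑, ((Submodule.span ℝ B : Set E)ᶜ)) := by
    refine dense_biInter_of_isOpen
      (fun B _ => (Submodule.closed_of_finiteDimensional _).isOpen_compl) h𝓑.countable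
      fun B hB => interior_eq_empty_iff_dense_compl.1 ?_
    by_contra hne
    have htop := Submodule.eq_top_of_nonempty_interior' _ (Set.nonempty_iff_ne_empty.2 hne)
    have hcard : (Set.finrank ℝ B) ≤ B.ncard := by
      have := hB.2.1.fintype
      rw [Set.ncard_eq_toFinset_card']
      exact finrank_span_le_card B
    rw [Set.finrank, htop, finrank_top] at hcard
    exact absurd hB.2.2 (not_lt.2 hcard)
  obtain ⟨w, hw, hwu⟩ := hdense.exists_dist_lt u hδ
  refine ⟨w, by rwa [dist_comm], fun B h1 h2 h3 => ?_⟩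
  simp only [Set.mem_iInter] at hw
  exact hw B ⟨h1, h2, h3⟩

/-- Fewer than `dim E` members of a generic family tie simultaneously in some direction in any
given closed half-space of directions. -/
lemma exists_ties [Finite ι] (hV : IsGenericFamily V) (u : E) (S : Finset ι)
    (hS : S.card < Module.finrank ℝ E) :
    ∃ c : StrongDual ℝ E, c ≠ 0 ∧ 0 ≤ c u ∧ ∀ i ∈ S, (maximizers c (V i)).Nontrivial := by
  classical
  by_contra! hno
  set K : Set (StrongDual ℝ E) := Metric.sphere 0 1 ∩
    ⋂ i ∈ S, {c | (maximizers c (V i)).Nontrivial} with hK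
  have hKc : IsCompact K := (isCompact_sphere 0 1).inter_right
    (isClosed_biInter fun i _ => isClosed_setOf_nontrivial_maximizers (hV.finite i))
  have hK0 : ∀ c ∈ K, c u < 0 := by
    rintro c ⟨hc1, hcS⟩
    simp only [Set.mem_iInter] at hcS
    by_contra! hcu
    obtain ⟨i, hi, hi'⟩ := hno c (by rintro rfl; simp at hc1) hcu
    exact absurd (hcS i hi) (Set.not_nontrivial_iff.2 hi')
  have hgen : ∀ δ > 0, ∃ w, dist w u < δ ∧ ∃ c ∈ K, 0 ≤ c w := by
    intro δ hδ
    obtain ⟨w, hwu, hw⟩ := hV.exists_generic_near u hδ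
    obtain ⟨c, hc, hcw, hcS⟩ := hV.exists_ties_of_generic hw S hS
    have hpos : 0 < ‖c‖⁻¹ := inv_pos.2 (norm_pos_iff.2 hc)
    refine ⟨w, hwu, ‖c‖⁻¹ • c,
      ⟨mem_sphere_zero_iff_norm.2 (norm_smul_inv_norm hc), ?_⟩, mul_nonneg hpos.le hcw⟩
    simp only [Set.mem_iInter]
    intro i hi
    rw [Set.mem_ofPred_eq, maximizers_smul c hpos]
    exact hcS i hi
  obtain ⟨_, _, c₁, hc₁, _⟩ := hgen 1 one_pos
  obtain ⟨c, hcK, hc⟩ := hKc.exists_isMaxOn ⟨c₁, hc₁⟩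
    (f := fun c : StrongDual ℝ E => c u) (by fun_prop)
  obtain ⟨w, hwu, b, hbK, hbw⟩ := hgen (-c u) (neg_pos.2 (hK0 c hcK))
  have h1 : b u ≤ c u := hc hbK
  have h2 : b (w - u) ≤ ‖w - u‖ := by
    have h := b.le_opNorm (w - u)
    have hb1 : ‖b‖ = 1 := by simpa using hbK.1
    rw [hb1, one_mul] at h
    exact (le_abs_self _).trans h
  rw [← dist_eq_norm, map_sub] at h2
  linarith

end IsGenericFamily

section alternating

variable {ι E : Type*} [Fintype ι] [DecidableEq ι]

lemma sum_powerset_neg_one_pow_mul_prod_ite (S : Finset ι) (f : ι → E → ℝ) (p q : ι → E) :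
    ∑ A ∈ S.powerset, (-1) ^ A.card * ∏ i, f i (if i ∈ A then p i else q i) =
      (∏ i ∈ S, (f i (q i) - f i (p i))) * ∏ i ∈ Sᶜ, f i (q i) := by
  rw [Finset.prod_sub, Finset.sum_mul]
  refine Finset.sum_congr rfl fun A hA => ?_
  rw [Finset.mem_powerset] at hA
  have h1 : ∏ i ∈ S, f i (if i ∈ A then p i else q i) =
      (∏ i ∈ S \ A, f i (q i)) * ∏ i ∈ A, f i (p i) := by
    rw [← Finset.prod_sdiff hA]
    refine congrArg₂ _ (Finset.prod_congr rfl fun i hi => ?_)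
      (Finset.prod_congr rfl fun i hi => by rw [if_pos hi])
    rw [if_neg (Finset.mem_sdiff.1 hi).2]
  have h2 : ∏ i ∈ Sᶜ, f i (if i ∈ A then p i else q i) = ∏ i ∈ Sᶜ, f i (q i) :=
    Finset.prod_congr rfl fun i hi => by
      rw [if_neg fun h => (Finset.mem_compl.1 hi) (hA h)]
  rw [← Finset.prod_mul_prod_compl S, h1, h2]
  ring

lemma sum_powerset_neg_one_pow_mul_prod (S T : Finset ι) (x : E → ℝ) (p q : ι → E) :
    ∑ A ∈ S.powerset, (-1) ^ A.card * ∏ i ∈ T, x (if i ∈ A then p i else q i) =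
      if S ⊆ T then (∏ i ∈ S, (x (q i) - x (p i))) * ∏ i ∈ T \ S, x (q i) else 0 := by
  have h := sum_powerset_neg_one_pow_mul_prod_ite S (fun i e => if i ∈ T then x e else 1) p q
  simp only [Finset.prod_ite_mem, Finset.univ_inter] at h
  rw [h]
  split_ifs with hST
  · refine congrArg₂ _ (Finset.prod_congr rfl fun i hi => by simp [hST hi]) ?_
    congr 1
    ext i
    simp [and_comm]
  · obtain ⟨i, hi, hiT⟩ := Finset.not_subset.1 hST
    rw [Finset.prod_eq_zero hi (by simp [hiT]), zero_mul]

lemma sum_powerset_neg_one_pow_mul_apply {S : Finset ι} (hS : 2 ≤ S.card) (g : E → ℝ) (j : ι)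
    (p q : ι → E) :
    ∑ A ∈ S.powerset, (-1) ^ A.card * g (if j ∈ A then p j else q j) = 0 := by
  have h := sum_powerset_neg_one_pow_mul_prod S {j} g p q
  have hSj : ¬ S ⊆ {j} := fun hS' => by
    have := Finset.card_le_card hS'
    rw [Finset.card_singleton] at this
    omega
  simpa [hSj] using h

end alternating

namespace IsGenericFamily

variable {ι E : Type*} [NormedAddCommGroup E] [NormedSpace ℝ E] [FiniteDimensional ℝ E]
  {V : ι → Set E} [Fintype ι]

/-- A function of the form `∑ i, g i (v i)` vanishing on all tuples of simultaneous maximizers has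
constant summands. -/
lemma eq_of_sum_eq_zero (hV : IsGenericFamily V) (hE : 2 ≤ Module.finrank ℝ E)
    (hexp : ∀ i, ∀ p ∈ V i, ∃ c : StrongDual ℝ E, c ≠ 0 ∧ p ∈ maximizers c (V i))
    {F : Set (ι → E)}
    (hF : ∀ c : StrongDual ℝ E, c ≠ 0 → ∀ v : ι → E, (∀ i, v i ∈ maximizers c (V i)) → v ∈ F)
    {g : ι → E → ℝ} (hg : ∀ v ∈ F, ∑ i, g i (v i) = 0) {i : ι} {p q : E}
    (hp : p ∈ V i) (hq : q ∈ V i) : g i p = g i q := by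
  classical
  by_contra hpq
  have hrank : 1 < Module.rank ℝ (StrongDual ℝ E) := by
    have h1 : Module.finrank ℝ (StrongDual ℝ E) = Module.finrank ℝ E := by
      rw [← (LinearMap.toContinuousLinearMap (𝕜 := ℝ) (E := E) (F' := ℝ)).finrank_eq]
      exact Subspace.dual_finrank_eq
    rw [← Module.finrank_eq_rank, h1]
    exact_mod_cast hE
  have hconn := (isConnected_compl_singleton_of_one_lt_rank hrank 0).isPreconnected
  set A := {r ∈ V i | g i r = g i p}
  set B := {r ∈ V i | g i r ≠ g i p}
  obtain ⟨c, hc, ⟨a, ha, hac⟩, b, hb, hbc⟩ := isPreconnected_closed_iff.1 hconn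
    {c | ∃ r ∈ A, r ∈ maximizers c (V i)} {c | ∃ r ∈ B, r ∈ maximizers c (V i)}
    (isClosed_setOf_exists_mem_maximizers ((hV.finite i).subset (Set.sep_subset _ _)))
    (isClosed_setOf_exists_mem_maximizers ((hV.finite i).subset (Set.sep_subset _ _)))
    (fun c _ => by
      obtain ⟨r, hr⟩ := hV.exists_mem_maximizers c i
      by_cases h : g i r = g i p
      · exact Or.inl ⟨r, ⟨hr.1, h⟩, hr⟩
      · exact Or.inr ⟨r, ⟨hr.1, h⟩, hr⟩)
    (by
      obtain ⟨c, hc, hcp⟩ := hexp i p hp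
      exact ⟨c, hc, p, ⟨hp, rfl⟩, hcp⟩)
    (by
      obtain ⟨c, hc, hcq⟩ := hexp i q hq
      exact ⟨c, hc, q, ⟨hq, Ne.symm hpq⟩, hcq⟩)
  choose v hv using fun j => hV.exists_mem_maximizers c j
  have hmem : ∀ r ∈ maximizers c (V i), g i r + ∑ j ∈ Finset.univ.erase i, g j (v j) = 0 := by
    intro r hr
    have h := hg (Function.update v i r) (hF c hc _ fun j => by
      by_cases hj : j = i
      · subst hj
        simpa using hr
      · simpa [hj] using hv j)
    rw [← Finset.add_sum_erase _ _ (Finset.mem_univ i)] at h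
    rw [← h, Function.update_self]
    refine congrArg₂ _ rfl (Finset.sum_congr rfl fun j hj => ?_)
    rw [Function.update_of_ne (Finset.ne_of_mem_erase hj)]
  have h1 := hmem a hac
  have h2 := hmem b hbc
  exact hb.2 (by linarith [ha.2])

variable [DecidableEq ι]

/-- The sets indexing the monomials used to bound the number of vertices from below. -/
def monomialSupports (i₀ : ι) (d : ℕ) : Finset (Finset ι) :=
  {T | 2 ≤ T.card ∧ (T.erase i₀).card < d}

lemma coeff_eq_zero (hV : IsGenericFamily V) (hE : 3 ≤ Module.finrank ℝ E)
    {F : Set (ι → E)}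
    (hF : ∀ c : StrongDual ℝ E, c ≠ 0 → ∀ v : ι → E, (∀ i, v i ∈ maximizers c (V i)) → v ∈ F)
    {x : E → ℝ} (hx : ∀ i, Set.InjOn x (V i)) (i₀ : ι) {a : Finset ι → ℝ} {g : ι → E → ℝ}
    (hag : ∀ v ∈ F, ∑ T ∈ monomialSupports i₀ (Module.finrank ℝ E), a T * ∏ i ∈ T, x (v i) +
      ∑ i, g i (v i) = 0) :
    ∀ T ∈ monomialSupports i₀ (Module.finrank ℝ E), a T = 0 := by
  set 𝓣 := monomialSupports i₀ (Module.finrank ℝ E) with h𝓣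
  have hmem : ∀ T, T ∈ 𝓣 ↔ 2 ≤ T.card ∧ (T.erase i₀).card < Module.finrank ℝ E := by
    simp [h𝓣, monomialSupports]
  have hvanish : ∀ c : StrongDual ℝ E, c ≠ 0 → ∀ S : Finset ι, 2 ≤ S.card → ∀ p q : ι → E,
      (∀ i ∈ S, p i ∈ maximizers c (V i)) → (∀ i, q i ∈ maximizers c (V i)) →
      ∑ T ∈ 𝓣, a T * (if S ⊆ T then
        (∏ i ∈ S, (x (q i) - x (p i))) * ∏ i ∈ T \ S, x (q i) else 0) = 0 := by
    intro c hc S hS p q hp hq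
    have h0 : ∑ A ∈ S.powerset, (-1 : ℝ) ^ A.card *
        (∑ T ∈ 𝓣, a T * ∏ i ∈ T, x (if i ∈ A then p i else q i) +
          ∑ i, g i (if i ∈ A then p i else q i)) = 0 := by
      refine Finset.sum_eq_zero fun A hA => ?_
      rw [hag (fun i => if i ∈ A then p i else q i) (hF c hc _ fun i => ?_), mul_zero]
      split_ifs with hi
      · exact hp i (Finset.mem_powerset.1 hA hi)
      · exact hq i
    simp only [mul_add, Finset.mul_sum, Finset.sum_add_distrib] at h0
    rw [Finset.sum_comm, Finset.sum_comm (t := Finset.univ),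
      Finset.sum_eq_zero (s := Finset.univ) fun i _ =>
        sum_powerset_neg_one_pow_mul_apply hS (g i) i p q, add_zero] at h0
    refine (Finset.sum_congr rfl fun T _ => ?_).trans h0
    rw [← sum_powerset_neg_one_pow_mul_prod, Finset.mul_sum]
    exact Finset.sum_congr rfl fun A _ => by ring
  have ties : ∀ (S : Finset ι) (u : E), S.card < Module.finrank ℝ E →
      ∃ c : StrongDual ℝ E, c ≠ 0 ∧ 0 ≤ c u ∧ ∃ p q : ι → E,
        (∀ i ∈ S, p i ∈ maximizers c (V i)) ∧ (∀ i, q i ∈ maximizers c (V i)) ∧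
        ∏ i ∈ S, (x (q i) - x (p i)) ≠ 0 := by
    intro S u hS
    obtain ⟨c, hc, hcu, hcS⟩ := hV.exists_ties u S hS
    choose q hq using fun j => hV.exists_mem_maximizers c j
    have : ∀ i ∈ S, ∃ p ∈ maximizers c (V i), p ≠ q i := fun i hi => (hcS i hi).exists_ne (q i)
    choose! p hp hpq using this
    refine ⟨c, hc, hcu, p, q, hp, hq, Finset.prod_ne_zero_iff.2 fun i hi => sub_ne_zero.2 fun h =>
      hpq i hi (hx i (hp i hi).1 (hq i).1 h.symm)⟩
  by_contra! hne
  obtain ⟨T₀, hT₀, haT₀⟩ := hne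
  obtain ⟨T, hT, hmax⟩ := Finset.exists_max_image (𝓣.filter fun T => a T ≠ 0) Finset.card
    ⟨T₀, Finset.mem_filter.2 ⟨hT₀, haT₀⟩⟩
  obtain ⟨hT𝓣, haT⟩ := Finset.mem_filter.1 hT
  obtain ⟨hT2, hTd⟩ := (hmem T).1 hT𝓣
  have hmax' : ∀ T' ∈ 𝓣, T.card < T'.card → a T' = 0 := fun T' hT' hlt => by
    by_contra hne
    exact absurd (hmax T' (Finset.mem_filter.2 ⟨hT', hne⟩)) (not_le.2 hlt)
  by_cases hcard : T.card < Module.finrank ℝ E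
  · obtain ⟨c, hc, -, p, q, hp, hq, hne⟩ := ties T 0 hcard
    have h := hvanish c hc T hT2 p q hp hq
    rw [Finset.sum_eq_single T] at h
    · simp only [subset_refl, if_true, sdiff_self, Finset.bot_eq_empty, Finset.prod_empty,
        mul_one] at h
      exact (mul_ne_zero haT hne) h
    · intro T' hT' hTT'
      split_ifs with hsub
      · rw [hmax' T' hT' (Finset.card_lt_card (hsub.ssubset_of_ne (Ne.symm hTT'))), zero_mul]
      · rw [mul_zero]
    · exact fun h => absurd hT𝓣 h
  · have hi₀ : i₀ ∈ T := by
      by_contra hi₀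
      rw [Finset.erase_eq_of_notMem hi₀] at hTd
      exact hcard hTd
    set S := T.erase i₀ with hS
    have hScard := Finset.card_erase_add_one hi₀
    rw [← hS] at hScard
    have hST : S ≠ T := fun h => by
      rw [h] at hScard
      omega
    have key : ∀ c : StrongDual ℝ E, c ≠ 0 → ∀ p q : ι → E,
        (∀ i ∈ S, p i ∈ maximizers c (V i)) → (∀ i, q i ∈ maximizers c (V i)) →
        ∏ i ∈ S, (x (q i) - x (p i)) ≠ 0 → a S + a T * x (q i₀) = 0 := by
      intro c hc p q hp hq hne
      have h := hvanish c hc S (by omega) p q hp hq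
      rw [Finset.sum_eq_add S T hST] at h
      · have hTS : T \ S = {i₀} := by
          rw [hS]
          ext i
          simp only [Finset.mem_sdiff, Finset.mem_erase, Finset.mem_singleton]
          constructor
          · rintro ⟨h1, h2⟩
            by_contra h3
            exact h2 ⟨h3, h1⟩
          · rintro rfl
            exact ⟨hi₀, fun h => h.1 rfl⟩
        rw [if_pos (subset_refl S), if_pos (Finset.erase_subset _ _), hTS, sdiff_self] at h
        simp only [Finset.bot_eq_empty, Finset.prod_empty, Finset.prod_singleton, mul_one] at h
        refine (mul_eq_zero.1 ?_).resolve_left hne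
        rw [← h]
        ring
      · rintro T' hT' ⟨h1, h2⟩
        rw [if_neg, mul_zero]
        intro hsub
        have hsub' : S ⊆ T'.erase i₀ := fun i hi =>
          Finset.mem_erase.2 ⟨(Finset.mem_erase.1 hi).1, hsub hi⟩
        have heq : S = T'.erase i₀ := Finset.eq_of_subset_of_card_le hsub' (by
          have := ((hmem T').1 hT').2
          omega)
        by_cases hi : i₀ ∈ T'
        · exact h2 (by rw [← Finset.insert_erase hi, ← heq, Finset.insert_erase hi₀])
        · exact h1 (by rw [heq, Finset.erase_eq_of_notMem hi])
      · exact fun h => absurd ((hmem S).2 ⟨by omega, by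
          rw [hS, Finset.erase_idem]
          exact hTd⟩) h
      · exact fun h => absurd hT𝓣 h
    obtain ⟨c, hc, -, p, q, hp, hq, hne⟩ := ties S 0 hTd
    obtain ⟨r, hr, hrq⟩ := (hV.nontrivial i₀).exists_ne (q i₀)
    obtain ⟨c', hc', hc'u, p', q', hp', hq', hne'⟩ := ties S (r - q i₀) hTd
    obtain ⟨s, hs, hsq⟩ : ∃ s ∈ maximizers c' (V i₀), s ≠ q i₀ := by
      by_cases h : q' i₀ = q i₀
      · refine ⟨r, ⟨hr, fun y hy => ((hq' i₀).2 y hy).trans ?_⟩, hrq⟩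
        rw [h]
        rw [map_sub] at hc'u
        linarith
      · exact ⟨q' i₀, hq' i₀, h⟩
    have hi₀S : i₀ ∉ S := Finset.notMem_erase _ _
    have hne'' : ∏ i ∈ S, (x (Function.update q' i₀ s i) - x (p' i)) ≠ 0 := by
      convert hne' using 1
      refine Finset.prod_congr rfl fun i hi => ?_
      rw [Function.update_of_ne (ne_of_mem_of_not_mem hi hi₀S)]
    have e1 := key c hc p q hp hq hne
    have e2 := key c' hc' p' (Function.update q' i₀ s) hp' (fun i => by
      by_cases hi : i = i₀
      · subst hi
        simpa using hs
      · simpa [hi] using hq' i) hne''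
    rw [Function.update_self] at e2
    have hxs : x s - x (q i₀) ≠ 0 := sub_ne_zero.2 fun h => hsq (hx i₀ hs.1 (hq i₀).1 h)
    exact mul_ne_zero haT hxs (by linarith)

end IsGenericFamily

namespace IsGenericFamily

lemma card_monomialSupports_add {ι : Type*} [Fintype ι] [DecidableEq ι] (i₀ : ι) {d : ℕ}
    (hd : 2 ≤ d) :
    (monomialSupports i₀ d).card + (Fintype.card ι + 1) =
      2 * ∑ k ∈ Finset.range d, (Fintype.card ι - 1).choose k := by
  have h1 : ({T : Finset ι | (T.erase i₀).card < d} : Finset (Finset ι)).card =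
      2 * ∑ k ∈ Finset.range d, (Fintype.card ι - 1).choose k := by
    have hsum : ∀ n : ℕ, ∑ k ∈ Finset.range (n + 1), n.choose k • (if k < d then 1 else 0) =
        ∑ k ∈ Finset.range d, n.choose k := by
      intro n
      simp only [smul_eq_mul, mul_ite, mul_one, mul_zero]
      rw [← Finset.sum_filter]
      refine Finset.sum_subset (fun k hk => by simp at hk ⊢; omega) fun k hk hk' => ?_
      refine Nat.choose_eq_zero_of_lt ?_
      simp at hk hk'
      omega
    have hi₀ : i₀ ∉ Finset.univ.erase i₀ := Finset.notMem_erase _ _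
    rw [Finset.card_filter, ← Finset.powerset_univ, ← Finset.insert_erase (Finset.mem_univ i₀),
      Finset.sum_powerset_insert hi₀, two_mul]
    have hcard : (Finset.univ.erase i₀).card = Fintype.card ι - 1 := by
      rw [Finset.card_erase_of_mem (Finset.mem_univ _), Finset.card_univ]
    have hnot : ∀ T ∈ (Finset.univ.erase i₀).powerset, i₀ ∉ T := fun T hT h =>
      hi₀ (Finset.mem_powerset.1 hT h)
    rw [← hsum, ← hcard, ← Finset.sum_powerset_apply_card]
    refine congrArg₂ _ (Finset.sum_congr rfl fun T hT => ?_) (Finset.sum_congr rfl fun T hT => ?_)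
    · rw [Finset.erase_eq_of_notMem (hnot T hT)]
    · rw [Finset.erase_insert (hnot T hT)]
  have h2 : ({T : Finset ι | T.card < 2} : Finset (Finset ι)).card = Fintype.card ι + 1 := by
    have : ({T : Finset ι | T.card < 2} : Finset (Finset ι)) =
        Finset.univ.powersetCard 1 ∪ Finset.univ.powersetCard 0 := by
      ext T
      simp only [Finset.mem_filter, Finset.mem_univ, true_and, Finset.mem_union,
        Finset.mem_powersetCard, Finset.subset_univ]
      omega
    rw [this, Finset.card_union_of_disjoint
      (Finset.disjoint_left.2 fun T h h' => by
        rw [Finset.mem_powersetCard] at h h'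
        omega)]
    simp
  rw [← h1, ← h2, ← Finset.card_union_of_disjoint]
  · congr 1
    ext T
    have := Finset.card_erase_le (s := T) (a := i₀)
    simp only [monomialSupports, Finset.mem_filter, Finset.mem_univ, true_and, Finset.mem_union]
    omega
  · rw [Finset.disjoint_left]
    intro T hT hT'
    simp [monomialSupports] at hT hT'
    omega

variable {ι E : Type*} [NormedAddCommGroup E] [NormedSpace ℝ E] [FiniteDimensional ℝ E]
  {V : ι → Set E} [Fintype ι] [DecidableEq ι]

lemma sum_ncard_add_card_monomialSupports_le (hV : IsGenericFamily V)
    (hE : 3 ≤ Module.finrank ℝ E)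
    (hexp : ∀ i, ∀ p ∈ V i, ∃ c : StrongDual ℝ E, c ≠ 0 ∧ p ∈ maximizers c (V i))
    {F : Set (ι → E)} (hFfin : F.Finite) (hFV : ∀ v ∈ F, ∀ i, v i ∈ V i)
    (hF : ∀ c : StrongDual ℝ E, c ≠ 0 → ∀ v : ι → E, (∀ i, v i ∈ maximizers c (V i)) → v ∈ F)
    (i₀ : ι) :
    (monomialSupports i₀ (Module.finrank ℝ E)).card + ∑ i, (V i).ncard ≤
      F.ncard + (Fintype.card ι - 1) := by
  set 𝓣 := monomialSupports i₀ (Module.finrank ℝ E)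
  have : ∀ i, Fintype (V i) := fun i => (hV.finite i).fintype
  have : Fintype F := hFfin.fintype
  obtain ⟨x, hx⟩ : ∃ x : E → ℝ, ∀ i, Set.InjOn x (V i) := by
    obtain ⟨f, hf⟩ := Set.countable_iff_exists_injOn.1
      (Set.finite_iUnion hV.finite).countable
    exact ⟨fun e => (f e : ℝ), fun i a ha b hb hab => hf (Set.mem_iUnion.2 ⟨i, ha⟩)
      (Set.mem_iUnion.2 ⟨i, hb⟩) (Nat.cast_injective hab)⟩
  have hbase : ∀ i, ∃ p, p ∈ V i := fun i => (hV.nontrivial i).nonempty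
  choose p hp using hbase
  let Φ : ((𝓣 → ℝ) × ((Σ i, V i) → ℝ)) →ₗ[ℝ] (F → ℝ) × ({i // i ≠ i₀} → ℝ) :=
    { toFun := fun ab =>
        (fun v => ∑ T : 𝓣, ab.1 T * ∏ i ∈ T.1, x (v.1 i) + ∑ i, ab.2 ⟨i, v.1 i, hFV v.1 v.2 i⟩,
          fun i => ab.2 ⟨i, p i, hp i⟩)
      map_add' := fun ab ab' => by
        ext
        · simp [add_mul, Finset.sum_add_distrib, add_add_add_comm]
        · simp
      map_smul' := fun t ab => by
        ext
        · simp [mul_add, Finset.mul_sum, mul_assoc]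
        · simp }
  have hΦ : Function.Injective Φ := by
    rw [← LinearMap.ker_eq_bot, LinearMap.ker_eq_bot']
    rintro ⟨a, b⟩ hab
    have hab1 : ∀ v (hv : v ∈ F), ∑ T : 𝓣, a T * ∏ i ∈ T.1, x (v i) +
        ∑ i, b ⟨i, v i, hFV v hv i⟩ = 0 := fun v hv => congrFun (congrArg Prod.fst hab) ⟨v, hv⟩
    have hab2 : ∀ i, i ≠ i₀ → b ⟨i, p i, hp i⟩ = 0 := fun i hi =>
      congrFun (congrArg Prod.snd hab) ⟨i, hi⟩
    classical
    set a' : Finset ι → ℝ := fun T => if h : T ∈ 𝓣 then a ⟨T, h⟩ else 0 with ha'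
    set g : ι → E → ℝ := fun i e => if h : e ∈ V i then b ⟨i, e, h⟩ else 0 with hg
    have hgb : ∀ i e (h : e ∈ V i), g i e = b ⟨i, e, h⟩ := fun i e h => by simp [hg, h]
    have hsum : ∀ v ∈ F, ∑ T ∈ 𝓣, a' T * ∏ i ∈ T, x (v i) + ∑ i, g i (v i) = 0 := by
      intro v hv
      rw [← hab1 v hv, ← Finset.sum_coe_sort 𝓣]
      refine congrArg₂ _ (Finset.sum_congr rfl fun T _ => ?_) (Finset.sum_congr rfl fun i _ => ?_)
      · simp [ha']
      · rw [hgb i _ (hFV v hv i)]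
    have hcoeff := hV.coeff_eq_zero hE hF hx i₀ hsum
    have hgsum : ∀ v ∈ F, ∑ i, g i (v i) = 0 := by
      intro v hv
      have := hsum v hv
      rwa [Finset.sum_eq_zero fun T hT => by rw [hcoeff T hT, zero_mul], zero_add] at this
    have hconst : ∀ i, ∀ e ∈ V i, g i e = g i (p i) := fun i e he =>
      hV.eq_of_sum_eq_zero (by omega) hexp hF hgsum he (hp i)
    have hgne : ∀ i, i ≠ i₀ → g i (p i) = 0 := fun i hi => by rw [hgb i _ (hp i), hab2 i hi]
    have hg0 : ∀ i, g i (p i) = 0 := by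
      intro i
      by_cases hi : i = i₀
      swap
      · exact hgne i hi
      subst hi
      have : Nontrivial (StrongDual ℝ E) := by
        obtain ⟨c, hc, -⟩ := hexp i (p i) (hp i)
        exact ⟨c, 0, hc⟩
      obtain ⟨c, hc⟩ := exists_ne (0 : StrongDual ℝ E)
      choose v hv using fun j => hV.exists_mem_maximizers c j
      rw [← hgsum v (hF c hc v hv), Finset.sum_eq_single i]
      · exact (hconst i _ (hv i).1).symm
      · intro j _ hj
        rw [hconst j _ (hv j).1, hgne j hj]
      · exact fun h => absurd (Finset.mem_univ i) h
    refine Prod.ext (funext fun T => ?_) (funext fun e => ?_)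
    · simpa [ha'] using hcoeff T.1 T.2
    · simpa [hg] using (hconst e.1 e.2.1 e.2.2).trans (hg0 e.1)
  have h := LinearMap.finrank_le_finrank_of_injective hΦ
  simp only [Module.finrank_prod, Module.finrank_fintype_fun_eq_card, Fintype.card_sigma,
    Fintype.card_coe, ← Nat.card_eq_fintype_card (α := ↑(V _)), ← Nat.card_eq_fintype_card (α := F),
    Nat.card_coe_set_eq, Fintype.card_subtype_compl, Fintype.card_unique] at h
  exact h

end IsGenericFamily

section Independence

variable {ι E : Type*} [Fintype ι] [AddCommGroup E] [Module ℝ E]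

lemma vectorSpan_sum_le (A : ι → Set E) :
    vectorSpan ℝ (∑ i, A i) ≤ ⨆ i, vectorSpan ℝ (A i) := by
  rw [vectorSpan_def, Submodule.span_le]
  rintro _ ⟨a', ha', b', hb', rfl⟩
  obtain ⟨a, ha, rfl⟩ := (Set.mem_fintype_sum _ _).1 ha'
  obtain ⟨b, hb, rfl⟩ := (Set.mem_fintype_sum _ _).1 hb'
  change ∑ i, a i - ∑ i, b i ∈ _
  rw [← Finset.sum_sub_distrib]
  exact Submodule.sum_mem _ fun i _ => le_iSup (fun i => vectorSpan ℝ (A i)) i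
    (vsub_mem_vectorSpan ℝ (ha i) (hb i))

/-- If dimensions add up under Minkowski summation, the directions are independent. -/
lemma iSupIndep_vectorSpan_of_finrank_eq [FiniteDimensional ℝ E] {A : ι → Set E}
    (h : Module.finrank ℝ (vectorSpan ℝ (∑ i, A i)) =
      ∑ i, Module.finrank ℝ (vectorSpan ℝ (A i))) :
    iSupIndep fun i => vectorSpan ℝ (A i) := by
  classical
  let f : (Π₀ i, vectorSpan ℝ (A i)) →ₗ[ℝ] E :=
    DFinsupp.lsum ℕ fun i => (vectorSpan ℝ (A i)).subtype
  have hf : Function.Injective f := by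
    have hle := Submodule.finrank_mono
      ((vectorSpan_sum_le A).trans_eq (Submodule.iSup_eq_range_dfinsupp_lsum _))
    have : Module.finrank ℝ (Π₀ i, vectorSpan ℝ (A i)) =
        ∑ i, Module.finrank ℝ (vectorSpan ℝ (A i)) := by
      rw [← Module.finrank_pi_fintype ℝ]
      exact LinearEquiv.finrank_eq (DFinsupp.linearEquivFunOnFintype (R := ℝ))
    have hrn := LinearMap.finrank_range_add_finrank_ker f
    have hfin : FiniteDimensional ℝ (Π₀ i, vectorSpan ℝ (A i)) :=
      Module.Finite.equiv (DFinsupp.linearEquivFunOnFintype (R := ℝ)).symm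
    rw [← LinearMap.ker_eq_bot, ← Submodule.finrank_eq_zero (R := ℝ)]
    change _ ≤ Module.finrank ℝ (LinearMap.range f) at hle
    omega
  exact iSupIndep_of_dfinsupp_lsum_injective _ hf

lemma iSupIndep.eq_zero_of_sum_eq_zero {p : ι → Submodule ℝ E} (h : iSupIndep p) {x : ι → E}
    (hx : ∀ i, x i ∈ p i) (h0 : ∑ i, x i = 0) (i : ι) : x i = 0 := by
  classical
  have hdis := Submodule.disjoint_def.1 (h i)
  refine hdis _ (hx i) ?_
  rw [← Finset.add_sum_erase _ _ (Finset.mem_univ i)] at h0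
  rw [eq_neg_of_add_eq_zero_left h0]
  refine Submodule.neg_mem _ (Submodule.sum_mem _ fun j hj => ?_)
  exact Submodule.mem_iSup_of_mem j (Submodule.mem_iSup_of_mem (Finset.ne_of_mem_erase hj) (hx j))

end Independence

section ConvexHull

variable {E : Type*} [NormedAddCommGroup E] [NormedSpace ℝ E]

lemma maximizers_subset_maximizers_convexHull (c : StrongDual ℝ E) (V : Set E) :
    maximizers c V ⊆ maximizers c (convexHull ℝ V) := by
  rintro x ⟨hx, hmax⟩
  exact ⟨subset_convexHull ℝ V hx,
    convexHull_min hmax (convex_halfSpace_le c.toLinearMap.isLinear (c x))⟩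

lemma finite_extremePoints_convexHull {S : Set E} (hS : S.Finite) :
    ((convexHull ℝ S).extremePoints ℝ).Finite :=
  hS.subset extremePoints_convexHull_subset

lemma convexHull_extremePoints_convexHull {S : Set E} (hS : S.Finite) :
    convexHull ℝ ((convexHull ℝ S).extremePoints ℝ) = convexHull ℝ S := by
  rw [← ((finite_extremePoints_convexHull hS).isClosed_convexHull ℝ).closure_eq]
  exact closure_convexHull_extremePoints (hS.isCompact_convexHull ℝ) (convex_convexHull ℝ S)

lemma exists_strictly_exposing {S : Set E} (hS : S.Finite) {p : E}
    (hp : p ∈ (convexHull ℝ S).extremePoints ℝ) :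
    ∃ c : StrongDual ℝ E, ∀ r ∈ (convexHull ℝ S).extremePoints ℝ, r ≠ p → c r < c p := by
  set V := (convexHull ℝ S).extremePoints ℝ
  have hpV : p ∉ convexHull ℝ (V \ {p}) := fun h =>
    (((convex_convexHull ℝ S).mem_extremePoints_iff_mem_sdiff_convexHull_sdiff).1 hp).2
      (convexHull_mono (Set.sdiff_subset_sdiff_left extremePoints_subset) h)
  obtain ⟨f, u, hfp, hf⟩ := geometric_hahn_banach_point_closed (convex_convexHull ℝ _)
    (((finite_extremePoints_convexHull hS).subset Set.sdiff_subset).isClosed_convexHull ℝ) hpV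
  refine ⟨-f, fun r hr hrp => ?_⟩
  have := hf r (subset_convexHull ℝ _ ⟨hr, hrp⟩)
  simp only [neg_apply]
  linarith

end ConvexHull

section MinkowskiSum

variable {ι E : Type*} [Fintype ι] [NormedAddCommGroup E] [NormedSpace ℝ E]

lemma finite_extremePoints_sum_convexHull {S : ι → Set E} (hS : ∀ i, (S i).Finite) :
    ((∑ i, convexHull ℝ (S i)).extremePoints ℝ).Finite := by
  rw [← convexHull_sum]
  refine finite_extremePoints_convexHull
    (((Set.Finite.pi' hS).image fun v => ∑ i, v i).subset fun x hx => ?_)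
  obtain ⟨v, hv, hvx⟩ := (Set.mem_fintype_sum _ _).1 hx
  exact ⟨v, hv, hvx⟩

/-- Vertices that simultaneously maximise a functional with independent faces sum to a vertex. -/
lemma sum_mem_extremePoints {P : ι → Set E} {c : StrongDual ℝ E}
    (hind : iSupIndep fun i => vectorSpan ℝ (maximizers c (P i))) {v : ι → E}
    (hv : ∀ i, v i ∈ (P i).extremePoints ℝ) (hc : ∀ i, v i ∈ maximizers c (P i)) :
    ∑ i, v i ∈ (∑ i, P i).extremePoints ℝ := by
  refine mem_extremePoints.2 ⟨Set.finsetSum_mem_finsetSum _ _ _ fun i _ => (hv i).1, ?_⟩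
  rintro a' ha' b' hb' ⟨s, t, hs, ht, hst, hab⟩
  obtain ⟨a, ha, rfl⟩ := (Set.mem_fintype_sum _ _).1 ha'
  obtain ⟨b, hb, rfl⟩ := (Set.mem_fintype_sum _ _).1 hb'
  have hsum : ∑ i, (s • a i + t • b i - v i) = 0 := by
    rw [Finset.sum_sub_distrib, Finset.sum_add_distrib, ← Finset.smul_sum, ← Finset.smul_sum, hab,
      sub_self]
  have hnonpos : ∀ i ∈ Finset.univ, c (s • a i + t • b i - v i) ≤ 0 := by
    intro i _
    have h1 := (hc i).2 _ (ha i)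
    have h2 := (hc i).2 _ (hb i)
    have h3 : c (v i) = s * c (v i) + t * c (v i) := by rw [← add_mul, hst, one_mul]
    simp only [map_sub, map_add, map_smul, smul_eq_mul]
    nlinarith
  have hzero : ∀ i ∈ Finset.univ, c (s • a i + t • b i - v i) = 0 :=
    (Finset.sum_eq_zero_iff_of_nonpos hnonpos).1 (by rw [← map_sum, hsum, map_zero])
  have hface : ∀ i, a i ∈ maximizers c (P i) ∧ b i ∈ maximizers c (P i) := by
    intro i
    have h0 := hzero i (Finset.mem_univ i)
    have h1 := (hc i).2 _ (ha i)
    have h2 := (hc i).2 _ (hb i)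
    simp only [map_sub, map_add, map_smul, smul_eq_mul] at h0
    have h3 : c (v i) = s * c (v i) + t * c (v i) := by rw [← add_mul, hst, one_mul]
    have h4 : c (v i) ≤ c (a i) := by nlinarith
    have h5 : c (v i) ≤ c (b i) := by nlinarith
    exact ⟨⟨ha i, fun y hy => ((hc i).2 y hy).trans h4⟩,
      ⟨hb i, fun y hy => ((hc i).2 y hy).trans h5⟩⟩
  have hspan : ∀ i, s • a i + t • b i - v i ∈ vectorSpan ℝ (maximizers c (P i)) := by
    intro i
    have : s • a i + t • b i - v i = s • (a i -ᵥ v i) + t • (b i -ᵥ v i) := by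
      rw [vsub_eq_sub, vsub_eq_sub, smul_sub, smul_sub, sub_add_sub_comm, ← add_smul, hst, one_smul]
    rw [this]
    exact Submodule.add_mem _
      (Submodule.smul_mem _ _ (vsub_mem_vectorSpan ℝ (hface i).1 (hc i)))
      (Submodule.smul_mem _ _ (vsub_mem_vectorSpan ℝ (hface i).2 (hc i)))
  have heq : ∀ i, a i = v i ∧ b i = v i := fun i =>
    (mem_extremePoints.1 (hv i)).2 _ (ha i) _ (hb i)
      ⟨s, t, hs, ht, hst, sub_eq_zero.1 (hind.eq_zero_of_sum_eq_zero hspan hsum i)⟩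
  exact ⟨Finset.sum_congr rfl fun i _ => (heq i).1, Finset.sum_congr rfl fun i _ => (heq i).2⟩

/-- An extreme point of a Minkowski sum decomposes uniquely. -/
lemma injOn_sum_extremePoints (P : ι → Set E) :
    Set.InjOn (fun v : ι → E => ∑ i, v i)
      {v | (∀ i, v i ∈ P i) ∧ ∑ i, v i ∈ (∑ i, P i).extremePoints ℝ} := by
  classical
  rintro v ⟨hv, hvx⟩ w ⟨hw, -⟩ (hvw : ∑ i, v i = ∑ i, w i)
  funext i
  have hsum : ∀ (u : ι → E) (y : E), ∑ j, Function.update u i y j = ∑ j, u j + (y - u i) := by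
    intro u y
    rw [Finset.sum_update_of_mem (Finset.mem_univ i),
      Finset.sum_eq_add_sum_sdiff_singleton_of_mem (Finset.mem_univ i) u]
    abel
  have hmem : ∀ u : ι → E, (∀ j, u j ∈ P j) → ∀ y ∈ P i, ∑ j, u j + (y - u i) ∈ ∑ j, P j := by
    intro u hu y hy
    rw [← hsum]
    refine Set.finsetSum_mem_finsetSum _ _ _ fun j _ => ?_
    rcases eq_or_ne j i with rfl | hj
    · rwa [Function.update_self]
    · rw [Function.update_of_ne hj]
      exact hu j
  have h := ((mem_extremePoints.1 hvx).2 _ (hmem v hv _ (hw i)) _ (hmem w hw _ (hv i))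
    ⟨1 / 2, 1 / 2, by norm_num, by norm_num, by norm_num, by rw [← hvw]; module⟩).1
  exact (sub_eq_zero.1 (add_eq_left.1 h)).symm

end MinkowskiSum

section Plane

/-- The normal vector of a linear functional on the plane, rotated by a quarter turn. -/
def rotatedNormal (c : StrongDual ℝ (Fin 2 → ℝ)) : Fin 2 → ℝ :=
  ![-c (Pi.single 1 1), c (Pi.single 0 1)]

lemma dual_apply_plane (c : StrongDual ℝ (Fin 2 → ℝ)) (x : Fin 2 → ℝ) :
    c x = x 0 * c (Pi.single 0 1) + x 1 * c (Pi.single 1 1) := by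
  have : x = x 0 • Pi.single 0 1 + x 1 • Pi.single 1 1 := by
    ext i
    fin_cases i <;> simp
  conv_lhs => rw [this]
  simp

lemma apply_rotatedNormal_comm (c c' : StrongDual ℝ (Fin 2 → ℝ)) :
    c (rotatedNormal c') = -c' (rotatedNormal c) := by
  rw [dual_apply_plane c, dual_apply_plane c']
  simp [rotatedNormal]
  ring

lemma rotatedNormal_ne_zero {c : StrongDual ℝ (Fin 2 → ℝ)} (hc : c ≠ 0) : rotatedNormal c ≠ 0 := by
  intro h
  have h0 := congrFun h 0
  have h1 := congrFun h 1
  simp only [rotatedNormal, Matrix.cons_val_zero, Matrix.cons_val_one, Pi.zero_apply,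
    neg_eq_zero] at h0 h1
  exact hc (ContinuousLinearMap.ext fun y => by rw [dual_apply_plane, h0, h1]; simp)

lemma exists_eq_smul_rotatedNormal {c : StrongDual ℝ (Fin 2 → ℝ)} (hc : c ≠ 0) {x : Fin 2 → ℝ}
    (hx : c x = 0) : ∃ l : ℝ, x = l • rotatedNormal c := by
  set a := c (Pi.single 0 1) with ha
  set b := c (Pi.single 1 1) with hb
  rw [dual_apply_plane, ← ha, ← hb] at hx
  have hab : 0 < a ^ 2 + b ^ 2 := by
    by_contra! h
    have ha0 : a = 0 := by nlinarith [sq_nonneg a, sq_nonneg b]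
    have hb0 : b = 0 := by nlinarith [sq_nonneg a, sq_nonneg b]
    exact rotatedNormal_ne_zero hc (by simp [rotatedNormal, ← ha, ← hb, ha0, hb0])
  refine ⟨(a * x 1 - b * x 0) / (a ^ 2 + b ^ 2), ?_⟩
  ext i
  fin_cases i
  · simp only [rotatedNormal, ← ha, ← hb]
    simp
    field_simp
    linear_combination a * hx
  · simp only [rotatedNormal, ← ha, ← hb]
    simp
    field_simp
    linear_combination b * hx

/-- The edge of a planar polygon leaving the vertex `p` in counterclockwise direction. -/
lemma exists_counterclockwise_edge {V : Set (Fin 2 → ℝ)} (hV : V.Finite) (hVn : V.Nontrivial)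
    {p : Fin 2 → ℝ} (hp : p ∈ V) {c₀ : StrongDual ℝ (Fin 2 → ℝ)}
    (hc₀ : ∀ r ∈ V, r ≠ p → c₀ r < c₀ p) :
    ∃ c : StrongDual ℝ (Fin 2 → ℝ), c ≠ 0 ∧ p ∈ maximizers c V ∧
      ∃ q ∈ maximizers c V, ∃ l : ℝ, 0 < l ∧ q - p = l • rotatedNormal c := by
  set α := c₀ (Pi.single 0 1) with hα
  set β := c₀ (Pi.single 1 1) with hβ
  let g : StrongDual ℝ (Fin 2 → ℝ) :=
    (-β) • ContinuousLinearMap.proj 0 + α • ContinuousLinearMap.proj 1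
  have hg : ∀ x, g x = -β * x 0 + α * x 1 := fun x => by simp [g]
  obtain ⟨q, ⟨hq, hqp⟩, hmax⟩ := Set.exists_max_image (V \ {p})
    (fun r => g (r - p) / -c₀ (r - p)) (hV.subset Set.sdiff_subset)
    (by obtain ⟨q, hq, hqp⟩ := hVn.exists_ne p; exact ⟨q, hq, hqp⟩)
  have hpos : ∀ r ∈ V, r ≠ p → 0 < -c₀ (r - p) := fun r hr hrp => by
    rw [map_sub]
    linarith [hc₀ r hr hrp]
  set t := g (q - p) / -c₀ (q - p) with ht
  have hqpos := hpos q hq hqp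
  have htq : g (q - p) = t * -c₀ (q - p) := (div_mul_cancel₀ _ hqpos.ne').symm
  set c := g + t • c₀ with hc
  have hcapp : ∀ x, c x = g x + t * c₀ x := fun x => by simp [c]
  have hcp : ∀ r ∈ V, c r ≤ c p := by
    intro r hr
    rcases eq_or_ne r p with rfl | hrp
    · exact le_rfl
    · have := (div_le_iff₀ (hpos r hr hrp)).1 (hmax r ⟨hr, hrp⟩)
      rw [map_sub, map_sub] at this
      rw [hcapp, hcapp]
      linarith
  have hcq : c (q - p) = 0 := by
    rw [hcapp, htq]
    ring
  have hcqp : c q = c p := by rwa [map_sub, sub_eq_zero] at hcq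
  have hca : c (Pi.single 0 1) = -β + t * α := by simp [hcapp, hg, ← hα]
  have hcb : c (Pi.single 1 1) = α + t * β := by simp [hcapp, hg, ← hβ]
  have hc₀q := dual_apply_plane c₀ (q - p)
  rw [← hα, ← hβ] at hc₀q
  have hgq := hg (q - p)
  set u := q - p
  have hdot : 0 < -(α + t * β) * u 0 + (-β + t * α) * u 1 := by
    have : -(α + t * β) * u 0 + (-β + t * α) * u 1 = -c₀ u * (1 + t ^ 2) := by
      rw [htq] at hgq
      linear_combination -t * hgq + hc₀q
    rw [this]
    positivity
  have hc0 : c ≠ 0 := by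
    intro h
    rw [h] at hca hcb
    simp only [zero_apply] at hca hcb
    rw [← hca, ← hcb] at hdot
    simp at hdot
  obtain ⟨l, hl⟩ := exists_eq_smul_rotatedNormal hc0 hcq
  refine ⟨c, hc0, ⟨hp, hcp⟩, q, ⟨hq, fun r hr => (hcp r hr).trans_eq hcqp.symm⟩, l, ?_, hl⟩
  have hu0 : u 0 = l * -(α + t * β) := by rw [hl, ← hcb]; simp [rotatedNormal]
  have hu1 : u 1 = l * (-β + t * α) := by rw [hl, ← hca]; simp [rotatedNormal]
  rw [hu0, hu1] at hdot
  by_contra! hneg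
  nlinarith [sq_nonneg (α + t * β), sq_nonneg (-β + t * α)]

lemma IsGenericFamily.sum_ncard_le_of_plane {ι : Type*} [Fintype ι] [DecidableEq ι]
    {V : ι → Set (Fin 2 → ℝ)} (hV : IsGenericFamily V)
    (hexp : ∀ i, ∀ p ∈ V i, ∃ c : StrongDual ℝ (Fin 2 → ℝ), ∀ r ∈ V i, r ≠ p → c r < c p)
    {F : Set (ι → Fin 2 → ℝ)} (hFfin : F.Finite)
    (hF : ∀ c : StrongDual ℝ (Fin 2 → ℝ), c ≠ 0 → ∀ v : ι → Fin 2 → ℝ,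
      (∀ i, v i ∈ maximizers c (V i)) → v ∈ F) :
    ∑ i, (V i).ncard ≤ F.ncard := by
  have hedge : ∀ a : Σ i, V i, ∃ c : StrongDual ℝ (Fin 2 → ℝ), c ≠ 0 ∧
      ∃ q ∈ maximizers c (V a.1), (∃ l : ℝ, 0 < l ∧ q - a.2 = l • rotatedNormal c) ∧
      ∃ v : ι → Fin 2 → ℝ, (∀ i, v i ∈ maximizers c (V i)) ∧ v a.1 = a.2 := by
    rintro ⟨i, p, hp⟩
    obtain ⟨c₀, hc₀⟩ := hexp i p hp
    obtain ⟨c, hc, hpc, q, hq, hl⟩ :=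
      exists_counterclockwise_edge (hV.finite i) (hV.nontrivial i) hp hc₀
    choose w hw using fun j => hV.exists_mem_maximizers c j
    refine ⟨c, hc, q, hq, hl, Function.update w i p, fun j => ?_, Function.update_self ..⟩
    rcases eq_or_ne j i with rfl | hj
    · rwa [Function.update_self]
    · rw [Function.update_of_ne hj]
      exact hw j
  choose c hc q hq hl v hv hva using hedge
  choose l hl hql using hl
  have hinj : Function.Injective fun a => (⟨v a, hF _ (hc a) _ (hv a)⟩ : F) := by
    intro a b hab
    have hab : v a = v b := congrArg Subtype.val hab
    by_cases hij : a.1 = b.1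
    · refine Sigma.subtype_ext hij ?_
      rw [← hva a, ← hva b, hab, hij]
    · exfalso
      have h1 : c a (q b - b.2) ≤ 0 := by
        rw [map_sub, ← hva b, ← hab]
        exact sub_nonpos.2 ((hv a b.1).2 _ (hq b).1)
      have h2 : c b (q a - a.2) ≤ 0 := by
        rw [map_sub, ← hva a, hab]
        exact sub_nonpos.2 ((hv b a.1).2 _ (hq a).1)
      have h3 : c a (q b - b.2) = 0 := by
        refine le_antisymm h1 ?_
        rw [hql, map_smul, smul_eq_mul] at h2 ⊢
        rw [apply_rotatedNormal_comm]
        exact mul_nonneg (hl b).le (neg_nonneg.2 (nonpos_of_mul_nonpos_right h2 (hl a)))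
      have hqa : c a (q b) = c a (v a b.1) := by
        rw [hab, hva b]
        rwa [map_sub, sub_eq_zero] at h3
      have hqb : q b ∈ maximizers (c a) (V b.1) :=
        ⟨(hq b).1, fun y hy => ((hv a b.1).2 y hy).trans_eq hqa.symm⟩
      have hmemb : q b - b.2 ∈ vectorSpan ℝ (maximizers (c a) (V b.1)) := by
        rw [← hva b, ← hab]
        exact vsub_mem_vectorSpan ℝ hqb (hv a b.1)
      have hmema : q a - a.2 ∈ vectorSpan ℝ (maximizers (c a) (V a.1)) := by
        rw [← hva a]
        exact vsub_mem_vectorSpan ℝ (hq a) (hv a a.1)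
      obtain ⟨s, hs⟩ := exists_eq_smul_rotatedNormal (hc a) h3
      have hpar : q b - b.2 = (s / l a) • (q a - a.2) := by
        rw [hs, hql a, smul_smul, div_mul_cancel₀ _ (hl a).ne']
      have hzero := Submodule.disjoint_def.1 ((hV.iSupIndep (c a) (hc a)).pairwiseDisjoint hij)
        (q b - b.2) (hpar ▸ Submodule.smul_mem _ _ hmema) hmemb
      rw [hql b, smul_eq_zero] at hzero
      exact hzero.elim (hl b).ne' (rotatedNormal_ne_zero (hc b))
  have : ∀ i, Fintype (V i) := fun i => (hV.finite i).fintype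
  have : Fintype F := hFfin.fintype
  have h := Nat.card_le_card_of_injective _ hinj
  rwa [Nat.card_sigma, Nat.card_coe_set_eq] at h

end Plane

section Line

lemma dual_apply_line (c : StrongDual ℝ (Fin 1 → ℝ)) (x : Fin 1 → ℝ) : c x = x 0 * c 1 := by
  have : x = x 0 • (1 : Fin 1 → ℝ) := by
    ext i
    fin_cases i
    simp
  conv_lhs => rw [this]
  simp

lemma IsGenericFamily.sum_ncard_add_two_le_of_line {ι : Type*} [Fintype ι]
    {V : ι → Set (Fin 1 → ℝ)} (hV : IsGenericFamily V)
    (hexp : ∀ i, ∀ p ∈ V i, ∃ c : StrongDual ℝ (Fin 1 → ℝ), ∀ r ∈ V i, r ≠ p → c r < c p)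
    {F : Set (ι → Fin 1 → ℝ)} (hFfin : F.Finite)
    (hF : ∀ c : StrongDual ℝ (Fin 1 → ℝ), c ≠ 0 → ∀ v : ι → Fin 1 → ℝ,
      (∀ i, v i ∈ maximizers c (V i)) → v ∈ F) (i₀ : ι) :
    ∑ i, (V i).ncard + 2 ≤ F.ncard + 2 * Fintype.card ι := by
  let e : StrongDual ℝ (Fin 1 → ℝ) := ContinuousLinearMap.proj 0
  have he : e ≠ 0 := fun h => one_ne_zero (congrArg (fun f : StrongDual ℝ (Fin 1 → ℝ) => f 1) h)
  choose v hv using hV.exists_mem_maximizers e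
  choose w hw using hV.exists_mem_maximizers (-e)
  have hvmax : ∀ i, ∀ r ∈ V i, r 0 ≤ v i 0 := fun i => (hv i).2
  have hwmin : ∀ i, ∀ r ∈ V i, w i 0 ≤ r 0 := fun i r hr => neg_le_neg_iff.1 ((hw i).2 r hr)
  have hcard : ∀ i ∈ Finset.univ, (V i).ncard ≤ 2 := by
    intro i _
    refine (Set.ncard_le_ncard (t := {v i, w i}) (fun r hr => ?_) (Set.toFinite _)).trans
      ((Set.ncard_insert_le _ _).trans (by simp))
    obtain ⟨c, hc⟩ := hexp i r hr
    by_contra hne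
    simp only [Set.mem_insert_iff, Set.mem_singleton_iff, not_or] at hne
    have h1 := hc _ (hv i).1 (Ne.symm hne.1)
    have h2 := hc _ (hw i).1 (Ne.symm hne.2)
    rw [dual_apply_line c, dual_apply_line c r] at h1 h2
    have h3 := hvmax i r hr
    have h4 := hwmin i r hr
    rcases le_total 0 (c 1) with h | h <;> nlinarith
  have hsum : ∑ i, (V i).ncard ≤ 2 * Fintype.card ι := by
    refine (Finset.sum_le_card_nsmul _ _ 2 hcard).trans_eq ?_
    rw [Finset.card_univ, smul_eq_mul, mul_comm]
  have hne : v ≠ w := by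
    intro h
    obtain ⟨x, hx, y, hy, hxy⟩ := hV.nontrivial i₀
    refine hxy (funext fun j => ?_)
    rw [Subsingleton.elim j 0]
    have h1 := hvmax i₀ x hx
    have h2 := hvmax i₀ y hy
    have h3 := hwmin i₀ x hx
    have h4 := hwmin i₀ y hy
    rw [← h] at h3 h4
    linarith
  have htwo : 1 < F.ncard := (Set.one_lt_ncard_iff hFfin).2
    ⟨v, w, hF e he v hv, hF (-e) (neg_ne_zero.2 he) w hw, hne⟩
  omega

end Line

section Polytope

variable {d m : ℕ} {P : Fin m → Set (Fin d → ℝ)}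

lemma InGeneralPosition.iSupIndep (hgen : InGeneralPosition P) {c : StrongDual ℝ (Fin d → ℝ)}
    (hc : c ≠ 0) : iSupIndep fun i => vectorSpan ℝ (maximizers c (P i)) :=
  iSupIndep_vectorSpan_of_finrank_eq <| hgen c.toLinearMap fun h =>
    hc (ContinuousLinearMap.coe_injective h)

lemma isGenericFamily_extremePoints (hpoly : ∀ i, IsPolytope (P i)) (hdim : ∀ i, 1 ≤ polyDim (P i))
    (hgen : InGeneralPosition P) : IsGenericFamily fun i => (P i).extremePoints ℝ where
  finite i := by
    obtain ⟨S, -, hS⟩ := hpoly i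
    rw [hS]
    exact finite_extremePoints_convexHull S.finite_toSet
  nontrivial i := by
    obtain ⟨S, -, hS⟩ := hpoly i
    by_contra h
    rw [Set.not_nontrivial_iff] at h
    have hP : (P i).Subsingleton := by
      rw [hS, ← convexHull_extremePoints_convexHull S.finite_toSet, ← hS]
      rcases h.eq_empty_or_singleton with h | ⟨x, h⟩ <;> simp [h]
    have := hdim i
    rw [polyDim, vectorSpan_of_subsingleton ℝ hP, finrank_bot] at this
    omega
  iSupIndep c hc := (hgen.iSupIndep hc).mono fun i => by
    obtain ⟨S, -, hS⟩ := hpoly i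
    refine vectorSpan_mono ℝ ((maximizers_subset_maximizers_convexHull c _).trans_eq ?_)
    rw [hS, convexHull_extremePoints_convexHull S.finite_toSet]

end Polytope

theorem lower_bound_for_vertices_of_minkowski_sums
    (d m : ℕ) (hd : 1 ≤ d) (hm : 1 ≤ m)
    (P : Fin m → Set (Fin d → ℝ))
    (hpoly : ∀ i, IsPolytope (P i))
    (hdim : ∀ i, 1 ≤ polyDim (P i))
    (hgen : InGeneralPosition P) :
    (∑ i, (Nat.card (Set.extremePoints ℝ (P i)) : ℤ))
        + 2 * ∑ k ∈ Finset.range d, ((m - 1).choose k : ℤ) - 2 * m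
      ≤ (Nat.card (Set.extremePoints ℝ (∑ i, P i)) : ℤ) := by
  have hV := isGenericFamily_extremePoints hpoly hdim hgen
  set V : Fin m → Set (Fin d → ℝ) := fun i => (P i).extremePoints ℝ with hVdef
  have hPV : ∀ i, convexHull ℝ (V i) = P i := fun i => by
    obtain ⟨S, -, hS⟩ := hpoly i
    simp only [hVdef, hS]
    exact convexHull_extremePoints_convexHull S.finite_toSet
  have hfin : ((∑ i, P i).extremePoints ℝ).Finite := by
    simp only [← hPV]
    exact finite_extremePoints_sum_convexHull hV.finite
  have hexp : ∀ i, ∀ p ∈ V i, ∃ c : StrongDual ℝ (Fin d → ℝ), ∀ r ∈ V i, r ≠ p → c r < c p := by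
    intro i p hp
    obtain ⟨S, -, hS⟩ := hpoly i
    simp only [hVdef, hS] at hp ⊢
    exact exists_strictly_exposing S.finite_toSet hp
  set F : Set (Fin m → Fin d → ℝ) :=
    {v | (∀ i, v i ∈ V i) ∧ ∑ i, v i ∈ (∑ i, P i).extremePoints ℝ} with hFdef
  have hinj : Set.InjOn (fun v : Fin m → Fin d → ℝ => ∑ i, v i) F :=
    by
    refine (injOn_sum_extremePoints P).mono fun v hv => ?_
    exact ⟨fun i => (hv.1 i).1, hv.2⟩
  have hmaps : Set.MapsTo (fun v : Fin m → Fin d → ℝ => ∑ i, v i) F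
    ((∑ i, P i).extremePoints ℝ) := fun v hv => hv.2
  have hFfin : F.Finite := Set.Finite.of_injOn hmaps hinj hfin
  have hFcard : F.ncard ≤ ((∑ i, P i).extremePoints ℝ).ncard :=
    Set.ncard_le_ncard_of_injOn _ hmaps hinj hfin
  have hF : ∀ c : StrongDual ℝ (Fin d → ℝ), c ≠ 0 → ∀ v : Fin m → Fin d → ℝ,
      (∀ i, v i ∈ maximizers c (V i)) → v ∈ F := fun c hc v hv =>
    ⟨fun i => (hv i).1, sum_mem_extremePoints (hgen.iSupIndep hc) (fun i => (hv i).1) fun i =>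
      hPV i ▸ maximizers_subset_maximizers_convexHull c _ (hv i)⟩
  simp only [Nat.card_coe_set_eq]
  suffices h : ∑ i, (V i).ncard + 2 * ∑ k ∈ Finset.range d, (m - 1).choose k ≤ F.ncard + 2 * m by
    have h' := h.trans (Nat.add_le_add_right hFcard _)
    zify at h'
    linarith
  have i₀ : Fin m := ⟨0, hm⟩
  obtain rfl | rfl | hd3 : d = 1 ∨ d = 2 ∨ 3 ≤ d := by omega
  · simpa using hV.sum_ncard_add_two_le_of_line hexp hFfin hF i₀
  · have := hV.sum_ncard_le_of_plane hexp hFfin hF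
    simp only [Finset.sum_range_succ, Finset.sum_range_zero, Nat.choose_zero_right,
      Nat.choose_one_right]
    omega
  · have hexp' : ∀ i, ∀ p ∈ V i,
        ∃ c : StrongDual ℝ (Fin d → ℝ), c ≠ 0 ∧ p ∈ maximizers c (V i) := by
      intro i p hp
      obtain ⟨c, hc⟩ := hexp i p hp
      refine ⟨c, ?_, hp, fun r hr => ?_⟩
      · rintro rfl
        obtain ⟨r, hr, hrp⟩ := (hV.nontrivial i).exists_ne p
        exact (hc r hr hrp).false
      · rcases eq_or_ne r p with rfl | hrp
        · exact le_rfl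
        · exact (hc r hr hrp).le
    have h1 := hV.sum_ncard_add_card_monomialSupports_le (by simpa using hd3) hexp' hFfin
      (fun v hv => hv.1) hF i₀
    have h2 := IsGenericFamily.card_monomialSupports_add i₀ (show 2 ≤ d by omega)
    simp only [Module.finrank_fin_fun, Fintype.card_fin] at h1 h2
    omega
end

section
/- (Region counting formula for arrangements of tropical curves in the plane.) Let f₁, …, f_m : ℝ² → ℝ (m ≥ 1) be tropical signomials such that N(fᵢ) ∩ N(fⱼ) is finite for all i < j and N(fᵢ) ∩ N(fⱼ) ∩ N(f_k) = ∅ for all i < j < k. Then the number of connected components of ℝ² ∖ (N(f₁) ∪ ⋯ ∪ N(f_m)) equals Σ_{i=1}^m (number of connected components of ℝ² ∖ N(fᵢ)) − (m − 1) + Σ_{i<j} |N(fᵢ) ∩ N(fⱼ)|. -/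
/-- A tropical signomial: the pointwise maximum of a nonempty finite family of affine
functions. -/
def IsTropSig {E : Type*} [AddCommGroup E] [Module ℝ E] (f : E → ℝ) : Prop :=
  ∃ (A : Finset (E →ᵃ[ℝ] ℝ)) (h : A.Nonempty), ∀ x, f x = A.sup' h (fun a => a x)

/-- The monomial length of a tropical signomial: the minimum cardinality of a finite set of
affine functions whose pointwise maximum is `f`. -/
noncomputable def mlen {E : Type*} [AddCommGroup E] [Module ℝ E] (f : E → ℝ) : ℕ :=
  sInf {k | ∃ (A : Finset (E →ᵃ[ℝ] ℝ)) (h : A.Nonempty),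
    A.card = k ∧ ∀ x, f x = A.sup' h (fun a => a x)}

/-- The factorization length of a tropical signomial: the minimum over all decompositions
`f = f₁ + ⋯ + f_m` into tropical signomials of `(Σᵢ mlen fᵢ) − (m − 1)`. -/
noncomputable def flen {E : Type*} [AddCommGroup E] [Module ℝ E] (f : E → ℝ) : ℕ :=
  sInf {k | ∃ (m : ℕ) (_ : 0 < m) (F : Fin m → E → ℝ),
    (∀ i, IsTropSig (F i)) ∧ (∀ x, f x = ∑ i, F i x) ∧
    k = (∑ i, mlen (F i)) - (m - 1)}

/-- The non-differentiability locus of `f` (the tropical hypersurface of `f`). -/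
def Ndiff {E : Type*} [NormedAddCommGroup E] [NormedSpace ℝ E] (f : E → ℝ) : Set E :=
  {x | ¬ DifferentiableAt ℝ f x}

/-- The number of regions of an arrangement `S ⊆ ℝ²`: the number of connected components of
its complement. -/
noncomputable def nregions (S : Set (ℝ × ℝ)) : ℕ :=
  Nat.card (ConnectedComponents ↥(Sᶜ))

open Set Function in
/-- The number of connected components of a set covered by disjoint nonempty connected open
sets is the number of these sets. -/
theorem card_connectedComponents_of_iUnion {X ι : Type*} [TopologicalSpace X] {S : Set X}
    {U : ι → Set X} (hopen : ∀ i, IsOpen (U i)) (hconn : ∀ i, IsConnected (U i))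
    (hdisj : Pairwise (Disjoint on U)) (hcov : ⋃ i, U i = S) :
    Nat.card (ConnectedComponents ↥S) = Nat.card ι := by
  have hex : ∀ x : S, ∃ i, (x : X) ∈ U i := fun x => mem_iUnion.1 (hcov.symm ▸ x.2)
  choose g hg using hex
  have huniq : ∀ (x : S) i, (x : X) ∈ U i → g x = i := fun x i hi => by
    by_contra hne
    exact Set.disjoint_left.1 (hdisj hne) (hg x) hi
  let _ : TopologicalSpace ι := ⊥
  have : DiscreteTopology ι := ⟨rfl⟩
  have hcont : Continuous g := by
    rw [continuous_discrete_rng]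
    intro i
    have : g ⁻¹' {i} = Subtype.val ⁻¹' U i := by
      ext x
      exact ⟨fun h => by have := hg x; rwa [show g x = i from h] at this, huniq x i⟩
    rw [this]
    exact (hopen i).preimage continuous_subtype_val
  refine Nat.card_congr (Equiv.ofBijective hcont.connectedComponentsLift ⟨?_, ?_⟩)
  · intro a b
    obtain ⟨x, rfl⟩ := ConnectedComponents.surjective_coe a
    obtain ⟨y, rfl⟩ := ConnectedComponents.surjective_coe b
    intro h
    simp only [Continuous.connectedComponentsLift_apply_coe] at h
    rw [ConnectedComponents.coe_eq_coe']
    have hsub : U (g y) ⊆ S := hcov ▸ subset_iUnion U (g y)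
    have hpre : IsPreconnected (Subtype.val ⁻¹' U (g y) : Set S) := by
      refine Topology.IsInducing.subtypeVal.isPreconnected_image.1 ?_
      rw [Subtype.image_preimage_coe, inter_eq_right.2 hsub]
      exact (hconn _).isPreconnected
    exact hpre.subset_connectedComponent (hg y) (by have := hg x; rwa [h] at this)
  · intro i
    obtain ⟨x, hx⟩ := (hconn i).nonempty
    have hxS : x ∈ S := hcov ▸ mem_iUnion_of_mem i hx
    exact ⟨((⟨x, hxS⟩ : S) : ConnectedComponents S), by
      rw [Continuous.connectedComponentsLift_apply_coe]; exact huniq _ _ hx⟩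

/-- Sample points for a finite set `T` of reals: one to the left of `T`, and one immediately to
the right of each point of `T`. -/
structure IsSampling (T : Finset ℝ) (s₀ : ℝ) (s : ℝ → ℝ) : Prop where
  lt : ∀ t ∈ T, s₀ < t
  lt_right : ∀ t ∈ T, t < s t
  right_lt : ∀ t ∈ T, ∀ u ∈ T, t < u → s t < u

theorem exists_isSampling (T : Finset ℝ) : ∃ s₀ s, IsSampling T s₀ s := by
  have h0 : ∃ s₀, ∀ t ∈ T, s₀ < t := by
    obtain ⟨b, hb⟩ := T.bddBelow
    exact ⟨b - 1, fun t ht => by have := hb ht; linarith⟩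
  have h1 : ∀ t : ℝ, ∃ v, t < v ∧ ∀ u ∈ T, t < u → v < u := by
    intro t
    have hev : ∀ᶠ v in nhdsWithin t (Set.Ioi t), ∀ u ∈ T, t < u → v < u := by
      rw [Filter.eventually_all_finset]
      intro u _
      by_cases h : t < u
      · filter_upwards [Ioo_mem_nhdsGT h] with v hv _ using hv.2
      · exact Filter.Eventually.of_forall fun v hv => absurd hv h
    obtain ⟨v, hv, hv'⟩ := (hev.and self_mem_nhdsWithin).exists
    exact ⟨v, hv', hv⟩
  obtain ⟨s₀, h0⟩ := h0
  choose s hs using h1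
  exact ⟨s₀, s, h0, fun t _ => (hs t).1, fun t _ => (hs t).2⟩

theorem IsSampling.left_notMem {T : Finset ℝ} {s₀ : ℝ} {s : ℝ → ℝ} (h : IsSampling T s₀ s) :
    s₀ ∉ T := fun hm => lt_irrefl _ (h.lt _ hm)

theorem IsSampling.right_notMem {T : Finset ℝ} {s₀ : ℝ} {s : ℝ → ℝ} (h : IsSampling T s₀ s)
    {t : ℝ} (ht : t ∈ T) : s t ∉ T :=
  fun hm => lt_irrefl _ (h.right_lt _ ht _ hm (h.lt_right _ ht))

/-- A connected open subset of the line is an open interval. -/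
theorem IsOpen.eq_interval {I : Set ℝ} (ho : IsOpen I) (hc : IsConnected I) :
    (∃ a b, a < b ∧ I = Set.Ioo a b) ∨ (∃ a, I = Set.Ioi a) ∨ (∃ b, I = Set.Iio b) ∨
      I = Set.univ := by
  have hi := ho.interior_eq
  have hne := hc.nonempty
  have key : (∃ a b, I = Set.Ioo a b) ∨ (∃ a, I = Set.Ioi a) ∨ (∃ b, I = Set.Iio b) ∨
      I = Set.univ := by
    have hm := hc.isPreconnected.mem_intervals
    simp only [Set.mem_insert_iff, Set.mem_singleton_iff] at hm
    rcases hm with h | h | h | h | h | h | h | h | h | h <;> rw [h] at hi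
    · exact .inl ⟨_, _, by rw [h, ← hi, interior_Icc]⟩
    · exact .inl ⟨_, _, by rw [h, ← hi, interior_Ico]⟩
    · exact .inl ⟨_, _, by rw [h, ← hi, interior_Ioc]⟩
    · exact .inl ⟨_, _, h⟩
    · exact .inr (.inl ⟨_, by rw [h, ← hi, interior_Ici]⟩)
    · exact .inr (.inl ⟨_, h⟩)
    · exact .inr (.inr (.inl ⟨_, by rw [h, ← hi, interior_Iic]⟩))
    · exact .inr (.inr (.inl ⟨_, h⟩))
    · exact .inr (.inr (.inr h))
    · exact absurd h hne.ne_empty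
  rcases key with ⟨a, b, rfl⟩ | h
  · exact .inl ⟨a, b, Set.nonempty_Ioo.1 hne, rfl⟩
  · exact .inr h

theorem IsOpen.finite_frontier_of_isConnected {I : Set ℝ} (ho : IsOpen I) (hc : IsConnected I) :
    (frontier I).Finite := by
  rcases ho.eq_interval hc with ⟨a, b, hab, rfl⟩ | ⟨a, rfl⟩ | ⟨b, rfl⟩ | rfl
  · rw [frontier_Ioo hab]; simp
  · rw [frontier_Ioi]; simp
  · rw [frontier_Iio]; simp
  · simp

open Classical in
/-- The Euler characteristic of an open interval, computed by sampling. -/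
theorem IsSampling.sum_interval {T : Finset ℝ} {s₀ : ℝ} {s : ℝ → ℝ} (h : IsSampling T s₀ s)
    {I : Set ℝ} (ho : IsOpen I) (hc : IsConnected I) (hT : frontier I ⊆ T) :
    (if s₀ ∈ I then (1 : ℤ) else 0) +
      ∑ t ∈ T, ((if s t ∈ I then 1 else 0) - (if t ∈ I then 1 else 0)) = 1 := by
  have hstart : ∀ a ∈ T,
      (∀ t ∈ T, ((if s t ∈ I then (1 : ℤ) else 0) - (if t ∈ I then 1 else 0))
        = if t = a then 1 else 0) →
      ∑ t ∈ T, ((if s t ∈ I then (1 : ℤ) else 0) - (if t ∈ I then 1 else 0)) = 1 := by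
    intro a ha hall
    rw [Finset.sum_congr rfl hall]
    simp [ha]
  have hnone : (∀ t ∈ T, ((if s t ∈ I then (1 : ℤ) else 0) - (if t ∈ I then 1 else 0)) = 0) →
      ∑ t ∈ T, ((if s t ∈ I then (1 : ℤ) else 0) - (if t ∈ I then 1 else 0)) = 0 :=
    Finset.sum_eq_zero
  have h1 := h.lt
  have h2 := h.lt_right
  have h3 := h.right_lt
  rcases ho.eq_interval hc with ⟨a, b, hab, rfl⟩ | ⟨a, rfl⟩ | ⟨b, rfl⟩ | rfl
  · rw [frontier_Ioo hab] at hT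
    have ha : a ∈ T := hT (by simp)
    have hb : b ∈ T := hT (by simp)
    rw [hstart a ha, if_neg (fun hh => lt_asymm hh.1 (h1 a ha)), zero_add]
    intro t ht
    have e1 := h2 t ht
    have e2 := h3 t ht a ha
    have e3 := h3 t ht b hb
    simp only [Set.mem_Ioo]
    grind
  · rw [frontier_Ioi] at hT
    have ha : a ∈ T := hT (by simp)
    rw [hstart a ha, if_neg (Set.notMem_Ioi.2 (h1 a ha).le), zero_add]
    intro t ht
    have e1 := h2 t ht
    have e2 := h3 t ht a ha
    simp only [Set.mem_Ioi]
    grind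
  · rw [frontier_Iio] at hT
    have hb : b ∈ T := hT (by simp)
    rw [hnone, if_pos (Set.mem_Iio.2 (h1 b hb)), add_zero]
    intro t ht
    have e1 := h2 t ht
    have e3 := h3 t ht b hb
    simp only [Set.mem_Iio]
    grind
  · simp

/-- A dissection of the complement of `N` into disjoint nonempty convex open regions. -/
structure IsConvexDissection {E ι : Type*} [TopologicalSpace E] [AddCommGroup E] [Module ℝ E]
    (N : Set E) (U : ι → Set E) : Prop where
  isOpen : ∀ i, IsOpen (U i)
  convex : ∀ i, Convex ℝ (U i)
  nonempty : ∀ i, (U i).Nonempty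
  disjoint : ∀ i j x, x ∈ U i → x ∈ U j → i = j
  mem_iff : ∀ x, x ∉ N ↔ ∃ i, x ∈ U i

theorem IsConvexDissection.nregions_eq {ι : Type*} {N : Set (ℝ × ℝ)} {U : ι → Set (ℝ × ℝ)}
    (h : IsConvexDissection N U) : nregions N = Nat.card ι := by
  refine card_connectedComponents_of_iUnion h.isOpen
    (fun i => ⟨h.nonempty i, (h.convex i).isPreconnected⟩) (fun i j hij => ?_) ?_
  · exact Set.disjoint_left.2 fun x hi hj => hij (h.disjoint i j x hi hj)
  · ext x
    simpa using (h.mem_iff x).symm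

open Classical in
/-- A finite set of `n` points dissects the line into `n + 1` intervals. -/
theorem IsConvexDissection.card_eq_ncard_add_one {ι : Type*} [Fintype ι] {F : Set ℝ}
    {V : ι → Set ℝ} (h : IsConvexDissection F V) (hF : F.Finite) :
    (Fintype.card ι : ℤ) = F.ncard + 1 := by
  obtain ⟨s₀, s, hs⟩ := exists_isSampling hF.toFinset
  have hfr : ∀ i, frontier (V i) ⊆ hF.toFinset := by
    intro i x hx
    rw [(h.isOpen i).frontier_eq] at hx
    rw [Set.Finite.coe_toFinset]
    by_contra hxF
    obtain ⟨j, hj⟩ := (h.mem_iff x).1 hxF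
    obtain ⟨y, hyj, hyi⟩ := mem_closure_iff.1 hx.1 _ (h.isOpen j) hj
    exact hx.2 (h.disjoint _ _ _ hyj hyi ▸ hj)
  have hone : ∀ x ∉ F, ∑ i, (if x ∈ V i then (1 : ℤ) else 0) = 1 := by
    intro x hx
    obtain ⟨i, hi⟩ := (h.mem_iff x).1 hx
    rw [Finset.sum_eq_single i (fun j _ hj => if_neg fun hxj => hj (h.disjoint _ _ _ hxj hi))
      (by simp), if_pos hi]
  have hzero : ∀ x ∈ F, ∑ i, (if x ∈ V i then (1 : ℤ) else 0) = 0 := by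
    intro x hx
    refine Finset.sum_eq_zero fun i _ => if_neg fun hi => ?_
    exact (h.mem_iff x).2 ⟨i, hi⟩ hx
  have hsum := Finset.sum_congr rfl fun i (_ : i ∈ (Finset.univ : Finset ι)) =>
    hs.sum_interval (h.isOpen i) ⟨h.nonempty i, (h.convex i).isPreconnected⟩ (hfr i)
  rw [Finset.sum_add_distrib, Finset.sum_comm] at hsum
  simp only [Finset.sum_sub_distrib] at hsum
  rw [hone s₀ (fun hm => hs.left_notMem (by simpa using hm)),
    Finset.sum_congr rfl (fun t ht => hone (s t) fun hm => hs.right_notMem ht (by simpa using hm)),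
    Finset.sum_congr rfl (fun t ht => hzero t (by simpa using ht))] at hsum
  rw [Set.ncard_eq_toFinset_card _ hF]
  simp at hsum
  linarith

/-- The sheared height `x + c y`, whose level sets are the lines swept across the plane. -/
def shearHeight (c : ℝ) (x : ℝ × ℝ) : ℝ := x.1 + c * x.2

/-- The parametrization of the level line `x + c y = u` by its second coordinate. -/
def levelLine (c u y : ℝ) : ℝ × ℝ := (u - c * y, y)

/-- The number of points of `N` on the level line `x + c y = u`. -/
noncomputable def levelCount (c : ℝ) (N : Set (ℝ × ℝ)) (u : ℝ) : ℕ :=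
  (levelLine c u ⁻¹' N).ncard

theorem shearHeight_levelLine (c u y : ℝ) : shearHeight c (levelLine c u y) = u := by
  simp [shearHeight, levelLine]

theorem levelLine_shearHeight (c : ℝ) (x : ℝ × ℝ) : levelLine c (shearHeight c x) x.2 = x := by
  simp [shearHeight, levelLine]

theorem continuous_levelLine (c u : ℝ) : Continuous (levelLine c u) := by
  unfold levelLine; fun_prop

theorem levelLine_eq_lineMap (c u y : ℝ) :
    levelLine c u y = AffineMap.lineMap (u, 0) (u - c, (1 : ℝ)) y := by
  simp [levelLine, AffineMap.lineMap_apply]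
  ring

theorem convex_preimage_levelLine (c u : ℝ) {U : Set (ℝ × ℝ)} (h : Convex ℝ U) :
    Convex ℝ (levelLine c u ⁻¹' U) := by
  rw [funext (levelLine_eq_lineMap c u)]
  exact h.affine_preimage _

theorem IsConvexDissection.isOpen_image {ι : Type*} {N : Set (ℝ × ℝ)} {U : ι → Set (ℝ × ℝ)}
    (h : IsConvexDissection N U) (c : ℝ) (i : ι) : IsOpen (shearHeight c '' U i) := by
  have : shearHeight c '' U i = ⋃ y : ℝ, (fun u => levelLine c u y) ⁻¹' U i := by
    ext u
    simp only [Set.mem_image, Set.mem_iUnion, Set.mem_preimage]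
    constructor
    · rintro ⟨x, hx, rfl⟩
      exact ⟨x.2, by rwa [levelLine_shearHeight]⟩
    · rintro ⟨y, hy⟩
      exact ⟨_, hy, shearHeight_levelLine c u y⟩
  rw [this]
  refine isOpen_iUnion fun y => (h.isOpen i).preimage ?_
  unfold levelLine; fun_prop

theorem IsConvexDissection.isConnected_image {ι : Type*} {N : Set (ℝ × ℝ)}
    {U : ι → Set (ℝ × ℝ)} (h : IsConvexDissection N U) (c : ℝ) (i : ι) :
    IsConnected (shearHeight c '' U i) := by
  refine IsConnected.image ⟨h.nonempty i, (h.convex i).isPreconnected⟩ _ ?_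
  unfold shearHeight; fun_prop

open Classical in
theorem IsConvexDissection.sum_level {ι : Type*} [Fintype ι] {N : Set (ℝ × ℝ)}
    {U : ι → Set (ℝ × ℝ)} (h : IsConvexDissection N U) {c u : ℝ}
    (hfin : (levelLine c u ⁻¹' N).Finite) :
    ∑ i, (if u ∈ shearHeight c '' U i then (1 : ℤ) else 0) = levelCount c N u + 1 := by
  have hmem : ∀ i, u ∈ shearHeight c '' U i ↔ (levelLine c u ⁻¹' U i).Nonempty := by
    intro i
    constructor
    · rintro ⟨x, hx, rfl⟩
      exact ⟨x.2, by rwa [Set.mem_preimage, levelLine_shearHeight]⟩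
    · rintro ⟨y, hy⟩
      exact ⟨_, hy, shearHeight_levelLine c u y⟩
  have hd : IsConvexDissection (levelLine c u ⁻¹' N)
      (fun i : {i // u ∈ shearHeight c '' U i} => levelLine c u ⁻¹' U i) :=
    { isOpen := fun i => (h.isOpen i).preimage (continuous_levelLine c u)
      convex := fun i => convex_preimage_levelLine c u (h.convex i)
      nonempty := fun i => (hmem i).1 i.2
      disjoint := fun i j y hi hj => Subtype.ext (h.disjoint i j _ hi hj)
      mem_iff := fun y => by
        rw [Set.mem_preimage, h.mem_iff]
        exact ⟨fun ⟨i, hi⟩ => ⟨⟨i, (hmem i).2 ⟨y, hi⟩⟩, hi⟩, fun ⟨i, hi⟩ => ⟨i, hi⟩⟩ }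
  rw [levelCount, ← hd.card_eq_ncard_add_one hfin, Fintype.card_subtype]
  simp

/-- The number of regions, computed by sweeping. -/
theorem IsConvexDissection.card_eq_sum_levelCount {ι : Type*} [Fintype ι] {N : Set (ℝ × ℝ)}
    {U : ι → Set (ℝ × ℝ)} (h : IsConvexDissection N U) {c : ℝ}
    (hfin : ∀ u, (levelLine c u ⁻¹' N).Finite) {T : Finset ℝ}
    (hT : ∀ i, frontier (shearHeight c '' U i) ⊆ T) {s₀ : ℝ} {s : ℝ → ℝ}
    (hs : IsSampling T s₀ s) :
    (Fintype.card ι : ℤ) = 1 + levelCount c N s₀ +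
      ∑ t ∈ T, ((levelCount c N (s t) : ℤ) - levelCount c N t) := by
  classical
  have hsum := Finset.sum_congr rfl fun i (_ : i ∈ (Finset.univ : Finset ι)) =>
    hs.sum_interval (h.isOpen_image c i) (h.isConnected_image c i) (hT i)
  rw [Finset.sum_add_distrib, Finset.sum_comm] at hsum
  simp only [Finset.sum_sub_distrib] at hsum
  simp only [h.sum_level (hfin _)] at hsum
  simp [Finset.sum_add_distrib] at hsum ⊢
  linarith

theorem sum_levelCount_eq_ncard {M : Set (ℝ × ℝ)} (hM : M.Finite) {c : ℝ} {T : Finset ℝ}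
    (hT : shearHeight c '' M ⊆ T) : ∑ t ∈ T, levelCount c M t = M.ncard := by
  classical
  rw [Set.ncard_eq_toFinset_card _ hM, Finset.card_eq_sum_card_fiberwise (f := shearHeight c)
    (t := T) (fun x hx => hT ⟨x, by simpa using hx, rfl⟩)]
  refine Finset.sum_congr rfl fun t _ => ?_
  have hinj : Function.Injective (levelLine c t) := fun y z hyz => congrArg Prod.snd hyz
  rw [levelCount, ← Set.ncard_image_of_injective _ hinj, ← Set.ncard_coe_finset]
  congr 1
  ext x
  simp only [Set.mem_image, Set.mem_preimage, Finset.coe_filter, Set.mem_ofPred_eq,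
    Set.Finite.mem_toFinset]
  constructor
  · rintro ⟨y, hy, rfl⟩
    exact ⟨hy, shearHeight_levelLine c t y⟩
  · rintro ⟨hx, rfl⟩
    exact ⟨x.2, by rwa [levelLine_shearHeight], levelLine_shearHeight c x⟩

theorem levelCount_eq_zero {M : Set (ℝ × ℝ)} {c u : ℝ} (hu : u ∉ shearHeight c '' M) :
    levelCount c M u = 0 := by
  have : levelLine c u ⁻¹' M = ∅ := Set.eq_empty_of_forall_notMem fun y hy =>
    hu ⟨_, hy, shearHeight_levelLine c u y⟩
  rw [levelCount, this, Set.ncard_empty]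

/-- Inclusion-exclusion for finite sets with empty triple intersections. -/
theorem ncard_iUnion_add_sum_ncard_inter {α ι : Type*} [Fintype ι] [LinearOrder ι]
    {S : ι → Set α} (hfin : ∀ i, (S i).Finite)
    (htriple : ∀ i j k, i < j → j < k → S i ∩ S j ∩ S k = ∅) :
    (⋃ i, S i).ncard + ∑ p ∈ Finset.univ.filter (fun p : ι × ι => p.1 < p.2),
      (S p.1 ∩ S p.2).ncard = ∑ i, (S i).ncard := by
  classical
  have hU : (⋃ i, S i).Finite := Set.finite_iUnion hfin
  have hcard : ∀ R : Set α, R ⊆ ⋃ i, S i →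
      R.ncard = ∑ x ∈ hU.toFinset, if x ∈ R then 1 else 0 := by
    intro R hR
    rw [Finset.sum_boole, ← Set.ncard_coe_finset, Nat.cast_id]
    congr 1
    ext x
    simp only [Finset.coe_filter, Set.Finite.mem_toFinset, Set.mem_ofPred_eq]
    exact ⟨fun h => ⟨hR h, h⟩, fun h => h.2⟩
  rw [hcard _ subset_rfl, Finset.sum_congr rfl fun (p : ι × ι) _ => hcard (S p.1 ∩ S p.2)
      (Set.inter_subset_left.trans (Set.subset_iUnion S _)),
    Finset.sum_congr rfl fun i _ => hcard (S i) (Set.subset_iUnion S _),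
    Finset.sum_comm, Finset.sum_comm (t := hU.toFinset), ← Finset.sum_add_distrib]
  refine Finset.sum_congr rfl fun x hx => ?_
  rw [Set.Finite.mem_toFinset] at hx
  rw [if_pos hx]
  obtain ⟨i, hi⟩ := Set.mem_iUnion.1 hx
  by_cases hj : ∃ j, j ≠ i ∧ x ∈ S j
  · obtain ⟨i, j, hij, hi, hj⟩ : ∃ i j, i < j ∧ x ∈ S i ∧ x ∈ S j := by
      obtain ⟨j, hne, hj⟩ := hj
      rcases lt_or_gt_of_ne hne with hlt | hlt
      · exact ⟨j, i, hlt, hj, hi⟩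
      · exact ⟨i, j, hlt, hi, hj⟩
    have hk : ∀ k, x ∈ S k → k = i ∨ k = j := by
      intro k hk
      by_contra! hne
      have ht : ∀ a b d, a < b → b < d → x ∈ S a → x ∈ S b → x ∈ S d → False :=
        fun a b d hab hbd ha hb hd => by
          have : x ∈ S a ∩ S b ∩ S d := ⟨⟨ha, hb⟩, hd⟩
          rw [htriple a b d hab hbd] at this
          exact this
      rcases lt_or_gt_of_ne hne.1 with h1 | h1
      · exact ht _ _ _ h1 hij hk hi hj
      · rcases lt_or_gt_of_ne hne.2 with h2 | h2
        · exact ht _ _ _ h1 h2 hi hk hj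
        · exact ht _ _ _ hij h2 hi hj hk
    rw [Finset.sum_eq_single_of_mem (i, j) (by simpa using hij), if_pos ⟨hi, hj⟩,
      Finset.sum_eq_add i j hij.ne, if_pos hi, if_pos hj]
    · exact fun k _ hne => if_neg fun h => (hk k h).elim hne.1 hne.2
    · simp
    · simp
    · rintro ⟨a, b⟩ hab hne
      refine if_neg fun ⟨ha, hb⟩ => hne ?_
      have hab : a < b := by simpa using hab
      rcases hk a ha with rfl | rfl <;> rcases hk b hb with rfl | rfl
      · exact absurd hab (lt_irrefl _)
      · rfl
      · exact absurd hab hij.asymm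
      · exact absurd hab (lt_irrefl _)
  · push Not at hj
    rw [Finset.sum_eq_single i (fun k _ hk => if_neg (hj k hk)) (by simp), if_pos hi,
      Finset.sum_eq_zero, add_zero]
    rintro ⟨a, b⟩ hab
    refine if_neg fun ⟨ha, hb⟩ => ?_
    have hab : a < b := by simpa using hab
    have ea : a = i := by_contra fun h => hj a h ha
    have eb : b = i := by_contra fun h => hj b h hb
    exact absurd hab (by rw [ea, eb]; exact lt_irrefl _)

/-- A maximum of finitely many affine functions is differentiable exactly where the maximum is
attained by only one of them. -/
theorem notMem_Ndiff_iff {E : Type*} [NormedAddCommGroup E] [NormedSpace ℝ E]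
    [FiniteDimensional ℝ E] {f : E → ℝ} {A : Finset (E →ᵃ[ℝ] ℝ)} (hA : A.Nonempty)
    (hf : ∀ x, f x = A.sup' hA (fun a => a x)) (x : E) :
    x ∉ Ndiff f ↔ ∃ a ∈ A, ∀ b ∈ A, b ≠ a → b x < a x := by
  have hcont : ∀ a : E →ᵃ[ℝ] ℝ, Continuous a := fun a => a.continuous_of_finiteDimensional
  have hderiv : ∀ (a : E →ᵃ[ℝ] ℝ) (x : E),
      HasFDerivAt a (LinearMap.toContinuousLinearMap a.linear) x := by
    intro a x
    have := (LinearMap.toContinuousLinearMap a.linear).hasFDerivAt (x := x)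
    have h2 := this.add_const (a 0)
    refine h2.congr_of_eventuallyEq (Filter.Eventually.of_forall fun y => ?_)
    have := congrFun a.decomp y
    simpa using this
  have hle : ∀ a ∈ A, ∀ y, a y ≤ f y := fun a ha y => by
    rw [hf]; exact Finset.le_sup' (fun a : E →ᵃ[ℝ] ℝ => a y) ha
  simp only [Ndiff, Set.mem_ofPred_eq, not_not]
  constructor
  · intro hd
    have hact : ∀ a ∈ A, a x = f x →
        fderiv ℝ f x = LinearMap.toContinuousLinearMap a.linear := by
      intro a ha hax
      have hmin : IsLocalMin (fun y => f y - a y) x :=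
        Filter.Eventually.of_forall fun y => by
          have := hle a ha y
          simp only [hax]
          linarith
      exact sub_eq_zero.1 (hmin.hasFDerivAt_eq_zero (hd.hasFDerivAt.sub (hderiv a x)))
    obtain ⟨a, ha, hax⟩ := Finset.exists_mem_eq_sup' hA (fun a : E →ᵃ[ℝ] ℝ => a x)
    have hax : a x = f x := by rw [hf, hax]
    refine ⟨a, ha, fun b hb hne => ?_⟩
    rw [hax]
    refine lt_of_le_of_ne (hle b hb x) fun hbx => hne ?_
    have hlin : b.linear = a.linear := by
      have := (hact b hb hbx).symm.trans (hact a ha hax)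
      exact LinearMap.toContinuousLinearMap.injective this
    ext y
    have h1 := b.linearMap_vsub y x
    have h2 := a.linearMap_vsub y x
    rw [hlin, h2] at h1
    simp only [vsub_eq_sub] at h1
    linarith
  · rintro ⟨a, ha, hb⟩
    have hev : ∀ᶠ y in nhds x, ∀ b ∈ A, b ≠ a → b y < a y := by
      rw [Filter.eventually_all_finset]
      intro b hbA
      by_cases hne : b = a
      · exact Filter.Eventually.of_forall fun y h => absurd hne h
      · filter_upwards [(hcont b).continuousAt.eventually_lt (hcont a).continuousAt
          (hb b hbA hne)] with y hy _ using hy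
    refine ((hderiv a x).differentiableAt).congr_of_eventuallyEq ?_
    filter_upwards [hev] with y hy
    refine le_antisymm ?_ (hle a ha y)
    rw [hf]
    refine Finset.sup'_le _ _ fun b hbA => ?_
    by_cases hne : b = a
    · rw [hne]
    · exact (hy b hbA hne).le

/-- The complement of the union of tropical hypersurfaces has a convex dissection. -/
theorem exists_isConvexDissection_iUnion.{u, v} {E : Type u} {κ : Type v}
    [NormedAddCommGroup E] [NormedSpace ℝ E] [FiniteDimensional ℝ E] [Finite κ] {f : κ → E → ℝ}
    (hf : ∀ k, IsTropSig (f k)) :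
    ∃ (ι : Type (max u v)) (_ : Fintype ι) (U : ι → Set E),
      IsConvexDissection (⋃ k, Ndiff (f k)) U := by
  classical
  choose A hA hfA using hf
  have hcont : ∀ a : E →ᵃ[ℝ] ℝ, Continuous a := fun a => a.continuous_of_finiteDimensional
  let W : (∀ k, A k) → Set E := fun a =>
    ⋂ k, ⋂ b : A k, {x | b ≠ a k → b.1 x < (a k).1 x}
  have hW : ∀ a x, x ∈ W a ↔ ∀ k, ∀ b : A k, b ≠ a k → b.1 x < (a k).1 x := by
    intro a x; simp [W]
  have _ := Fintype.ofFinite κ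
  refine ⟨{a : ∀ k, A k // (W a).Nonempty}, Fintype.ofFinite _, fun a => W a, ?_, ?_, ?_, ?_, ?_⟩
  · refine fun a => isOpen_iInter_of_finite fun k => isOpen_iInter_of_finite fun b => ?_
    by_cases hb : b = a.1 k
    · simp [hb]
    · simpa [hb] using isOpen_lt (hcont _) (hcont _)
  · refine fun a => convex_iInter fun k => convex_iInter fun b => ?_
    by_cases hb : b = a.1 k
    · simpa [hb] using convex_univ
    · have : {x | b ≠ a.1 k → b.1 x < (a.1 k).1 x}
          = ((a.1 k).1 - b.1 : E →ᵃ[ℝ] ℝ) ⁻¹' Set.Ioi 0 := by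
        ext x; simp [hb]
      rw [this]
      exact (convex_Ioi 0).affine_preimage _
  · exact fun a => a.2
  · intro a b x ha hb
    rw [hW] at ha hb
    refine Subtype.ext (funext fun k => by_contra fun hne => ?_)
    exact lt_asymm (hb k _ hne) (ha k _ (Ne.symm hne))
  · intro x
    rw [Set.mem_iUnion, not_exists]
    simp only [notMem_Ndiff_iff (hA _) (hfA _)]
    constructor
    · intro h
      choose a ha hb using h
      have hx : x ∈ W fun k => ⟨a k, ha k⟩ :=
        (hW _ _).2 fun k b hne => hb k b b.2 fun h => hne (Subtype.ext h)
      exact ⟨⟨_, x, hx⟩, hx⟩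
    · rintro ⟨a, ha⟩ k
      rw [hW] at ha
      exact ⟨a.1 k, (a.1 k).2, fun b hb hne => ha k ⟨b, hb⟩ fun h => hne (congrArg Subtype.val h)⟩

/-- For all but finitely many slopes, every level line meets the tropical curve in finitely many
points. -/
theorem IsTropSig.eventually_finite_preimage_levelLine {f : ℝ × ℝ → ℝ} (hf : IsTropSig f) :
    ∀ᶠ c in Filter.cofinite, ∀ u, (levelLine c u ⁻¹' Ndiff f).Finite := by
  obtain ⟨A, hA, hfA⟩ := hf
  have hpair : ∀ a ∈ A, ∀ b ∈ A, ∀ᶠ c in Filter.cofinite, a ≠ b →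
      ∀ u, {y | a (levelLine c u y) = b (levelLine c u y)}.Finite := by
    intro a _ b _
    set d : (ℝ × ℝ) →ᵃ[ℝ] ℝ := a - b with hd
    have hform : ∀ x y : ℝ, d (x, y) = x * d.linear (1, 0) + y * d.linear (0, 1) + d 0 := by
      intro x y
      have h := congrFun d.decomp (x, y)
      have h2 : ((x, y) : ℝ × ℝ) = x • (1, 0) + y • (0, 1) := by simp
      simp only [Pi.add_apply] at h
      rw [h, h2, map_add, map_smul, map_smul, smul_eq_mul, smul_eq_mul]
    by_cases hz : d.linear (1, 0) = 0 ∧ d.linear (0, 1) = 0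
    · refine Filter.Eventually.of_forall fun c hab u => ?_
      convert Set.finite_empty
      refine Set.eq_empty_of_forall_notMem fun y hy => hab ?_
      have hy : d (levelLine c u y) = 0 := by simpa [hd, sub_eq_zero] using hy
      rw [levelLine, hform, hz.1, hz.2] at hy
      ext ⟨x, y⟩
      have := hform x y
      rw [hz.1, hz.2] at this
      have h3 : d (x, y) = 0 := by linarith
      simpa [hd, sub_eq_zero] using h3
    · have hfinc : {c : ℝ | d.linear (0, 1) = c * d.linear (1, 0)}.Finite := by
        refine Set.Subsingleton.finite fun c hc e he => ?_
        simp only [Set.mem_ofPred_eq] at hc he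
        have h1 : d.linear (1, 0) ≠ 0 := fun h => hz ⟨h, by rw [hc, h, mul_zero]⟩
        exact mul_right_cancel₀ h1 (hc.symm.trans he)
      filter_upwards [hfinc.compl_mem_cofinite] with c hc _ u
      refine Set.Subsingleton.finite fun y hy z hz => ?_
      have hy : d (levelLine c u y) = 0 := by simpa [hd, sub_eq_zero] using hy
      have hz : d (levelLine c u z) = 0 := by simpa [hd, sub_eq_zero] using hz
      rw [levelLine, hform] at hy hz
      have h0 : d.linear (0, 1) - c * d.linear (1, 0) ≠ 0 := sub_ne_zero.2 hc
      refine mul_left_cancel₀ h0 ?_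
      linarith
  have hall : ∀ᶠ c in Filter.cofinite, ∀ a ∈ A, ∀ b ∈ A, a ≠ b →
      ∀ u, {y | a (levelLine c u y) = b (levelLine c u y)}.Finite := by
    simp only [Filter.eventually_all_finset]
    exact hpair
  filter_upwards [hall] with c hc u
  have hfin : (⋃ a ∈ A, ⋃ b ∈ A,
      {y | a ≠ b ∧ a (levelLine c u y) = b (levelLine c u y)}).Finite := by
    refine A.finite_toSet.biUnion fun a ha => A.finite_toSet.biUnion fun b hb => ?_
    by_cases hab : a = b
    · simp [hab]
    · exact (hc a ha b hb hab u).subset fun y hy => hy.2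
  refine hfin.subset fun y hy => ?_
  by_contra hno
  refine (notMem_Ndiff_iff hA hfA (levelLine c u y)).2 ?_ hy
  obtain ⟨a, ha, hmax⟩ := A.exists_max_image (fun a => a (levelLine c u y)) hA
  refine ⟨a, ha, fun b hb hne => lt_of_le_of_ne (hmax b hb) fun heq => hno ?_⟩
  simp only [Set.mem_iUnion]
  exact ⟨b, hb, a, ha, hne, heq⟩

theorem region_counting_formula_tropical_curves
    (m : ℕ) (hm : 1 ≤ m) (f : Fin m → ℝ × ℝ → ℝ)
    (hts : ∀ i, IsTropSig (f i))
    (hfin : ∀ i j : Fin m, i < j → (Ndiff (f i) ∩ Ndiff (f j)).Finite)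
    (htriple : ∀ i j k : Fin m, i < j → j < k →
      Ndiff (f i) ∩ Ndiff (f j) ∩ Ndiff (f k) = ∅) :
    nregions (⋃ i, Ndiff (f i)) + (m - 1)
      = (∑ i, nregions (Ndiff (f i)))
        + ∑ p ∈ Finset.univ.filter (fun p : Fin m × Fin m => p.1 < p.2),
            Nat.card ↥(Ndiff (f p.1) ∩ Ndiff (f p.2)) := by
  classical
  obtain ⟨c, hc⟩ : ∃ c, ∀ i u, (levelLine c u ⁻¹' Ndiff (f i)).Finite :=
    (Filter.eventually_all.2 fun i => (hts i).eventually_finite_preimage_levelLine).exists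
  have hcU : ∀ u, (levelLine c u ⁻¹' ⋃ i, Ndiff (f i)).Finite := fun u => by
    rw [Set.preimage_iUnion]
    exact Set.finite_iUnion fun i => hc i u
  obtain ⟨ι, _, U, hU⟩ := exists_isConvexDissection_iUnion hts
  have hsingle : ∀ i, ∃ (κ : Type) (_ : Fintype κ) (V : κ → Set (ℝ × ℝ)),
      IsConvexDissection (Ndiff (f i)) V := fun i => by
    simpa only [Set.iUnion_const] using exists_isConvexDissection_iUnion fun _ : Unit => hts i
  choose κ _ V hV using hsingle
  set P := Finset.univ.filter (fun p : Fin m × Fin m => p.1 < p.2) with hP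
  have hPfin : ∀ p ∈ P, (Ndiff (f p.1) ∩ Ndiff (f p.2)).Finite := fun p hp =>
    hfin _ _ (by simpa [hP] using hp)
  have hTfin : ((⋃ j, frontier (shearHeight c '' U j)) ∪
      (⋃ i, ⋃ j, frontier (shearHeight c '' V i j)) ∪
      ⋃ p ∈ P, shearHeight c '' (Ndiff (f p.1) ∩ Ndiff (f p.2))).Finite := by
    refine ((Set.finite_iUnion fun j => ?_).union
      (Set.finite_iUnion fun i => Set.finite_iUnion fun j => ?_)).union
      (P.finite_toSet.biUnion fun p hp => (hPfin p hp).image _)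
    · exact (hU.isOpen_image c j).finite_frontier_of_isConnected (hU.isConnected_image c j)
    · exact ((hV i).isOpen_image c j).finite_frontier_of_isConnected ((hV i).isConnected_image c j)
  obtain ⟨T, hT⟩ := hTfin.exists_finset_coe
  have hTU : ∀ j, frontier (shearHeight c '' U j) ⊆ T := fun j => by
    rw [hT]
    exact fun x hx => .inl (.inl (Set.mem_iUnion_of_mem j hx))
  have hTV : ∀ i j, frontier (shearHeight c '' V i j) ⊆ T := fun i j => by
    rw [hT]
    exact fun x hx => .inl (.inr (Set.mem_iUnion_of_mem i (Set.mem_iUnion_of_mem j hx)))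
  have hTP : ∀ p ∈ P, shearHeight c '' (Ndiff (f p.1) ∩ Ndiff (f p.2)) ⊆ T := fun p hp => by
    rw [hT]
    exact fun x hx => .inr (Set.mem_biUnion hp hx)
  obtain ⟨s₀, s, hs⟩ := exists_isSampling T
  have hie : ∀ u, (levelCount c (⋃ i, Ndiff (f i)) u : ℤ) =
      ∑ i, (levelCount c (Ndiff (f i)) u : ℤ) -
        ∑ p ∈ P, (levelCount c (Ndiff (f p.1) ∩ Ndiff (f p.2)) u : ℤ) := by
    intro u
    have := ncard_iUnion_add_sum_ncard_inter (fun i => hc i u) fun i j k hij hjk => by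
      rw [← Set.preimage_inter, ← Set.preimage_inter, htriple i j k hij hjk, Set.preimage_empty]
    rw [← Set.preimage_iUnion] at this
    simp only [levelCount, Set.preimage_inter]
    rw [eq_sub_iff_add_eq]
    exact_mod_cast this
  have hoff : ∀ u ∉ T, ∑ p ∈ P, (levelCount c (Ndiff (f p.1) ∩ Ndiff (f p.2)) u : ℤ) = 0 :=
    fun u hu => Finset.sum_eq_zero fun p hp => by
      rw [levelCount_eq_zero fun h => hu (hTP p hp h), Nat.cast_zero]
  have hpairs : ∑ t ∈ T, ∑ p ∈ P, (levelCount c (Ndiff (f p.1) ∩ Ndiff (f p.2)) t : ℤ) =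
      ∑ p ∈ P, ((Ndiff (f p.1) ∩ Ndiff (f p.2)).ncard : ℤ) := by
    rw [Finset.sum_comm]
    refine Finset.sum_congr rfl fun p hp => ?_
    exact_mod_cast sum_levelCount_eq_ncard (hPfin p hp) (hTP p hp)
  have hmain := hU.card_eq_sum_levelCount hcU hTU hs
  have hright : ∑ t ∈ T, ((levelCount c (⋃ i, Ndiff (f i)) (s t) : ℤ)) =
      ∑ t ∈ T, ∑ i, (levelCount c (Ndiff (f i)) (s t) : ℤ) :=
    Finset.sum_congr rfl fun t ht => by rw [hie, hoff _ (hs.right_notMem ht), sub_zero]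
  have hparts : ∑ i, (Fintype.card (κ i) : ℤ) = m + ∑ i, (levelCount c (Ndiff (f i)) s₀ : ℤ) +
      (∑ t ∈ T, ∑ i, (levelCount c (Ndiff (f i)) (s t) : ℤ) -
        ∑ t ∈ T, ∑ i, (levelCount c (Ndiff (f i)) t : ℤ)) := by
    rw [Finset.sum_congr rfl fun i _ => (hV i).card_eq_sum_levelCount (hc i) (hTV i) hs,
      Finset.sum_add_distrib, Finset.sum_add_distrib, Finset.sum_comm (t := T),
      ← Finset.sum_sub_distrib]
    simp [Finset.sum_sub_distrib]
  rw [Finset.sum_sub_distrib, hright, hie s₀, hoff s₀ hs.left_notMem,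
    Finset.sum_congr rfl fun t _ => hie t, Finset.sum_sub_distrib, hpairs] at hmain
  rw [hU.nregions_eq, Finset.sum_congr rfl fun i _ => (hV i).nregions_eq]
  simp only [Nat.card_eq_fintype_card (α := ι), Nat.card_eq_fintype_card (α := κ _),
    Nat.card_coe_set_eq]
  zify [hm]
  linarith
end
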